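/- arXiv:2411.17574 — 2 statements merged into one kernel-verified Lean document; each statement's English description precedes it below -/
import Mathlib

section
/- Let V ⊂ ℝ¹⁰ be the set of 18 points e₁, e₂, e₃, e₄, −(e₁+e₂+e₃+e₄), e₅, e₆, e₇, e₈, −(e₅+e₆+e₇+e₈), e₉, −e₉, e₁₀, −e₁₀, e₁+e₅, e₁+e₅+e₉, e₂+e₆, e₂+e₆+e₁₀, let P = {x ∈ ℝ¹⁰ : ⟨x, v⟩ ≥ −1 for every v ∈ V}, and let θ be the unique affine function on ℝ¹⁰ satisfying ∫_P θ(x) dx = 0 and ∫_P x_i·θ(x) dx = ∫_P x_i dx for i = 1, …, 10. Then θ(x) ≤ θ(v*) for every x ∈ P, where v* = (−1, 4, −1, −1, 4, −1, −1, −1, 1, 1); that is, the maximum of θ over P is attained at the vertex v*. -/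
noncomputable section

open MeasureTheory
open scoped RealInnerProductSpace

/-- The standard basis vectors of `ℝ¹⁰`. -/
def ee (i : Fin 10) : EuclideanSpace ℝ (Fin 10) := EuclideanSpace.single i 1

/-- The 18 points `e₁, e₂, e₃, e₄, −(e₁+e₂+e₃+e₄), e₅, e₆, e₇, e₈, −(e₅+e₆+e₇+e₈),
e₉, −e₉, e₁₀, −e₁₀, e₁+e₅, e₁+e₅+e₉, e₂+e₆, e₂+e₆+e₁₀` (0-indexed here). -/
def V18 : Set (EuclideanSpace ℝ (Fin 10)) :=
  {ee 0, ee 1, ee 2, ee 3, -(ee 0 + ee 1 + ee 2 + ee 3),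
   ee 4, ee 5, ee 6, ee 7, -(ee 4 + ee 5 + ee 6 + ee 7),
   ee 8, -ee 8, ee 9, -ee 9,
   ee 0 + ee 4, ee 0 + ee 4 + ee 8,
   ee 1 + ee 5, ee 1 + ee 5 + ee 9}

/-- The moment polytope `P = {x ∈ ℝ¹⁰ : ⟪x, v⟫ ≥ −1 for every v ∈ V18}`. -/
def P : Set (EuclideanSpace ℝ (Fin 10)) := {x | ∀ v ∈ V18, ⟪x, v⟫ ≥ -1}

/-- The vertex `v* = (−1, 4, −1, −1, 4, −1, −1, −1, 1, 1)` of `P`. -/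
def vstar : EuclideanSpace ℝ (Fin 10) :=
  (WithLp.equiv 2 (Fin 10 → ℝ)).symm ![-1, 4, -1, -1, 4, -1, -1, -1, 1, 1]


namespace PolyInt

/-- Polynomials in `n` variables with integer coefficients, as nested coefficient lists. -/
@[reducible] def Pol (n : ℕ) : Type := Nat.rec ℤ (fun _ T => List T) n

/-- Addition of coefficient lists. -/
def addL {α : Type} (f : α → α → α) (l : List α) : List α → List α :=
  List.rec (fun m => m) (fun a l ih m => List.rec (a :: l) (fun b m _ => f a b :: ih m) m) l

def mapL {α : Type} (f : α → α) (l : List α) : List α :=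
  List.rec [] (fun a _ ih => f a :: ih) l

/-- Multiplication of coefficient lists. -/
def mulL {α : Type} (z : α) (ad mu : α → α → α) (l m : List α) : List α :=
  List.rec [] (fun a l ih =>
    List.rec (mapL (mu a) m) (fun _ _ _ => addL ad (mapL (mu a) m) (z :: ih)) l) l

def pzero (n : ℕ) : Pol n := Nat.rec (0 : ℤ) (fun _ _ => []) n

def padd (n : ℕ) : Pol n → Pol n → Pol n :=
  Nat.rec (fun (a b : ℤ) => Int.add a b) (fun _ f => addL f) n

def pmul (n : ℕ) : Pol n → Pol n → Pol n :=
  Nat.rec (fun (a b : ℤ) => Int.mul a b) (fun n f => mulL (pzero n) (padd n) f) n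

def pscale (q : ℤ) (n : ℕ) : Pol n → Pol n :=
  Nat.rec (fun (a : ℤ) => Int.mul q a) (fun _ f => mapL f) n

def pconst (q : ℤ) (n : ℕ) : Pol n := Nat.rec q (fun _ p => [p]) n

def pvar (i : ℕ) (n : ℕ) : Pol n :=
  Nat.rec (0 : ℤ) (fun n p => Bool.rec [p] [pzero n, pconst 1 n] (Nat.beq i n)) n

/-- Coefficients of `360360` times the antiderivative divided by the variable to the
power `k + 1`. -/
def anti (n : ℕ) (l : List (Pol n)) : ℕ → List (Pol n) :=
  List.rec (fun _ => [])
    (fun c _ ih k => pscale (Int.ofNat (360360 / (k + 1))) n c :: ih (k + 1)) l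

def horner (n : ℕ) (b : Pol n) (l : List (Pol n)) : Pol n :=
  List.rec (pzero n) (fun a _ ih => padd n a (pmul n b ih)) l

/-- Integrating out the last variable between polynomial bounds, times `360360`. -/
def integ (n : ℕ) (p : List (Pol n)) (lo hi : Pol n) : Pol n :=
  padd n (pmul n hi (horner n hi (anti n p 0)))
    (pscale (-1) n (pmul n lo (horner n lo (anti n p 0))))

/-- Evaluation of a coefficient list. -/
def evalL {α : Type} (g : α → ℝ) (t : ℝ) : List α → ℝ
  | [] => 0
  | a :: l => g a + t * evalL g t l

def ev : (n : ℕ) → Pol n → (Fin n → ℝ) → ℝ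
  | 0 => fun (q : ℤ) _ => (q : ℝ)
  | n + 1 => fun p x => evalL (fun c => ev n c (fun i => x i.castSucc)) (x (Fin.last n)) p

lemma evalL_addL {α : Type} (f : α → α → α) (g : α → ℝ) (t : ℝ)
    (h : ∀ a b, g (f a b) = g a + g b) (l m : List α) :
    evalL g t (addL f l m) = evalL g t l + evalL g t m := by
  induction l generalizing m with
  | nil => simp [addL, evalL]
  | cons a l ih =>
    cases m with
    | nil => simp [addL, evalL]
    | cons b m =>
      change g (f a b) + t * evalL g t (addL f l m) = (g a + t * _) + (g b + t * _)
      rw [h, ih]; ring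

lemma evalL_map {α : Type} (f : α → α) (g : α → ℝ) (t s : ℝ)
    (h : ∀ a, g (f a) = s * g a) (l : List α) :
    evalL g t (mapL f l) = s * evalL g t l := by
  induction l with
  | nil => simp [evalL, mapL]
  | cons a l ih =>
    change g (f a) + t * evalL g t (mapL f l) = s * (g a + t * _)
    rw [h, ih]; ring

@[simp] lemma ev_zero (n : ℕ) (x : Fin n → ℝ) : ev n (pzero n) x = 0 := by
  cases n <;> simp [ev, pzero, evalL]

@[simp] lemma ev_add (n : ℕ) (p q : Pol n) (x : Fin n → ℝ) :
    ev n (padd n p q) x = ev n p x + ev n q x := by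
  induction n with
  | zero => exact Int.cast_add p q
  | succ n ih => exact evalL_addL _ _ _ (fun a b => ih a b _) p q

@[simp] lemma ev_scale (s : ℤ) (n : ℕ) (p : Pol n) (x : Fin n → ℝ) :
    ev n (pscale s n p) x = s * ev n p x := by
  induction n with
  | zero => exact Int.cast_mul s p
  | succ n ih => exact evalL_map _ _ _ _ (fun a => ih a _) p

@[simp] lemma ev_mul (n : ℕ) (p q : Pol n) (x : Fin n → ℝ) :
    ev n (pmul n p q) x = ev n p x * ev n q x := by
  induction n with
  | zero => exact Int.cast_mul p q
  | succ n ih =>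
    change evalL _ _ (mulL (pzero n) (padd n) (pmul n) p q) = evalL _ _ p * evalL _ _ q
    induction p with
    | nil => simp [mulL, evalL]
    | cons a l ihl =>
      have hmap := evalL_map (pmul n a) (fun c => ev n c (fun i => x i.castSucc)) (x (Fin.last n))
        (ev n a (fun i => x i.castSucc)) (fun b => ih a b _) q
      cases l with
      | nil =>
        refine hmap.trans ?_
        simp [evalL]
      | cons a' l =>
        change evalL _ _ (addL (padd n) (mapL (pmul n a) q)
          (pzero n :: mulL (pzero n) (padd n) (pmul n) (a' :: l) q)) = _
        rw [evalL_addL _ _ _ (fun a b => ev_add n a b _), hmap]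
        conv_lhs => rw [evalL, ihl, ev_zero]
        conv_rhs => rw [evalL]
        ring

@[simp] lemma ev_const (s : ℤ) (n : ℕ) (x : Fin n → ℝ) : ev n (pconst s n) x = s := by
  induction n with
  | zero => simp [ev, pconst]
  | succ n ih => 
    change ev n (pconst s n) _ + _ * 0 = _
    rw [ih]; ring

lemma ev_var (i n : ℕ) (h : i < n) (x : Fin n → ℝ) : ev n (pvar i n) x = x ⟨i, h⟩ := by
  induction n with
  | zero => omega
  | succ n ih =>
    by_cases hi : i = n
    · subst hi
      simp [ev, pvar, evalL, Fin.last]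
    · have : Nat.beq i n = false := by
        rw [Bool.eq_false_iff]
        exact fun h => hi (Nat.eq_of_beq_eq_true h)
      have hpv : pvar i (n + 1) = [pvar i n] := by
        change (Bool.rec [pvar i n] [pzero n, pconst 1 n] (Nat.beq i n) : List (Pol n)) = _
        rw [this]
      rw [hpv]
      change ev n (pvar i n) _ + _ * 0 = _
      rw [ih (by omega)]
      simp

lemma ev_horner (n : ℕ) (b : Pol n) (l : List (Pol n)) (x : Fin n → ℝ) :
    ev n (horner n b l) x = evalL (fun c => ev n c x) (ev n b x) l := by
  induction l with
  | nil => simp [horner, evalL]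
  | cons a l ih =>
    change ev n (padd n a (pmul n b (horner n b l))) x = _
    rw [ev_add, ev_mul, ih]; rfl

lemma hasDerivAt_anti (n : ℕ) (x : Fin n → ℝ) (l : List (Pol n)) (k : ℕ) (t : ℝ)
    (hl : l.length + k ≤ 15) :
    HasDerivAt (fun t => t ^ (k + 1) * evalL (fun c => ev n c x) t (anti n l k))
      (360360 * (t ^ k * evalL (fun c => ev n c x) t l)) t := by
  induction l generalizing k with
  | nil => simpa [anti, evalL] using hasDerivAt_const t (0 : ℝ)
  | cons c l ih =>
    have hl' : l.length + 1 + k ≤ 15 := hl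
    have h1 := ih (k + 1) (by omega)
    have hdiv : ((k + 1 : ℕ) : ℝ) * ((Int.ofNat (360360 / (k + 1)) : ℤ) : ℝ) = 360360 := by
      have : (k + 1) * (360360 / (k + 1)) = 360360 := by
        have hk : k ≤ 14 := by omega
        interval_cases k <;> rfl
      rw [Int.ofNat_eq_natCast, Int.cast_natCast]
      exact_mod_cast this
    have h2 := ((hasDerivAt_id t).pow (k + 1)).mul_const
      (((Int.ofNat (360360 / (k + 1)) : ℤ) : ℝ) * ev n c x)
    have h3 := h2.add h1
    have e1 : (fun t => t ^ (k + 1) * evalL (fun c => ev n c x) t (anti n (c :: l) k)) =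
        (fun y => (id ^ (k + 1)) y * (((Int.ofNat (360360 / (k + 1)) : ℤ) : ℝ) * ev n c x)) +
          fun t => t ^ (k + 1 + 1) * evalL (fun c => ev n c x) t (anti n l (k + 1)) := by
      funext s
      change s ^ (k + 1) * (ev n (pscale _ n c) x + s * evalL _ s (anti n l (k + 1))) =
        s ^ (k + 1) * _ + _
      rw [ev_scale]
      ring
    have e2 : 360360 * (t ^ k * evalL (fun c => ev n c x) t (c :: l)) =
        ((k + 1 : ℕ) : ℝ) * id t ^ (k + 1 - 1) * 1 *
          (((Int.ofNat (360360 / (k + 1)) : ℤ) : ℝ) * ev n c x) +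
          360360 * (t ^ (k + 1) * evalL (fun c => ev n c x) t l) := by
      rw [show ∀ u v w z : ℝ, u * v * 1 * (w * z) = (u * w) * v * z by intros; ring, hdiv]
      simp [evalL]
      ring
    rw [e1, e2]
    exact h3

lemma continuous_evalL (n : ℕ) (x : Fin n → ℝ) (l : List (Pol n)) :
    Continuous fun t => evalL (fun c => ev n c x) t l := by
  induction l with
  | nil => exact continuous_const
  | cons a l ih => exact continuous_const.add (continuous_id.mul ih)

lemma continuous_ev (n : ℕ) (p : Pol n) : Continuous (ev n p) := by
  induction n with
  | zero => exact continuous_const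
  | succ n ih =>
    change Continuous fun x => evalL _ _ p
    induction p with
    | nil => exact continuous_const
    | cons a l ihl =>
      exact ((ih a).comp (by fun_prop)).add ((continuous_apply _).mul ihl)

lemma ev_integ (n : ℕ) (p : List (Pol n)) (lo hi : Pol n) (x : Fin n → ℝ)
    (hp : p.length ≤ 15) :
    ev n (integ n p lo hi) x =
      360360 * ∫ t in (ev n lo x)..(ev n hi x), evalL (fun c => ev n c x) t p := by
  rw [← intervalIntegral.integral_const_mul, intervalIntegral.integral_eq_sub_of_hasDerivAt
    (f := fun t => t ^ (0 + 1) * evalL (fun c => ev n c x) t (anti n p 0))]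
  · simp [integ, ev_horner]; ring
  · intro t _
    simpa using hasDerivAt_anti n x p 0 t (by omega)
  · exact ((continuous_evalL n x p).const_smul (360360 : ℝ)).intervalIntegrable _ _

/-- Iterated regions: polynomial bounds for each variable in terms of the previous ones;
the flag says whether the upper bound is strict. -/
inductive Reg : ℕ → Type
  | nil : Reg 0
  | cons {n : ℕ} (R : Reg n) (lo hi : Pol n) (s : Bool) : Reg (n + 1)

/-- An interval `[lo, hi)` or `[lo, hi]`. -/
def ivl (s : Bool) (lo hi : ℝ) : Set ℝ := bif s then Set.Ico lo hi else Set.Icc lo hi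

def rset : {n : ℕ} → Reg n → Set (Fin n → ℝ)
  | 0, Reg.nil => Set.univ
  | n + 1, Reg.cons R lo hi s =>
    {x | (fun i : Fin n => x i.castSucc) ∈ rset R ∧
      x (Fin.last n) ∈ ivl s (ev n lo fun i => x i.castSucc) (ev n hi fun i => x i.castSucc)}

def valid : {n : ℕ} → Reg n → Prop
  | 0, Reg.nil => True
  | n + 1, Reg.cons R lo hi _ => valid R ∧ ∀ x ∈ rset R, ev n lo x ≤ ev n hi x

/-- The integral over an iterated region, times `360360 ^ n`; `none` when a degree is too
large for the scaling factor. -/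
def intAll {n : ℕ} (R : Reg n) : Pol n → Option ℤ :=
  Reg.rec (motive := fun n _ => Pol n → Option ℤ) (fun q => some q)
    (fun {n} _ lo hi _ ih p => Bool.rec none (ih (integ n p lo hi))
      (Nat.ble (List.length (p : List (Pol n))) 15)) R

lemma mem_rset_cons {n : ℕ} (R : Reg n) (lo hi : Pol n) (s : Bool) (x : Fin (n + 1) → ℝ) :
    x ∈ rset (Reg.cons R lo hi s) ↔ (fun i : Fin n => x i.castSucc) ∈ rset R ∧
      x (Fin.last n) ∈ ivl s (ev n lo fun i => x i.castSucc) (ev n hi fun i => x i.castSucc) :=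
  Iff.rfl

lemma setIntegral_ivl (s : Bool) (a b : ℝ) (h : a ≤ b) (f : ℝ → ℝ) :
    ∫ t in ivl s a b, f t = ∫ t in a..b, f t := by
  rw [intervalIntegral.integral_of_le h]
  cases s
  · exact integral_Icc_eq_integral_Ioc
  · exact integral_Ico_eq_integral_Ioc

lemma ivl_subset (s : Bool) (a b : ℝ) : ivl s a b ⊆ Set.Icc a b := by
  cases s
  · exact subset_rfl
  · exact Set.Ico_subset_Icc_self

lemma measurableSet_rset {n : ℕ} (R : Reg n) : MeasurableSet (rset R) := by
  induction R with
  | nil => exact MeasurableSet.univ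
  | @cons n R lo hi s ih =>
    have h0 : Measurable fun x : Fin (n + 1) → ℝ => (fun i : Fin n => x i.castSucc) := by
      fun_prop
    have hl := (continuous_ev n lo).measurable.comp h0
    have hh := (continuous_ev n hi).measurable.comp h0
    have hx : Measurable fun x : Fin (n + 1) → ℝ => x (Fin.last n) := measurable_pi_apply _
    refine (h0 ih).inter ?_
    cases s
    · exact (measurableSet_le hl hx).inter (measurableSet_le hx hh)
    · exact (measurableSet_le hl hx).inter (measurableSet_lt hx hh)

lemma bounded_rset {n : ℕ} (R : Reg n) : ∃ K, IsCompact K ∧ rset R ⊆ K := by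
  induction R with
  | nil => exact ⟨Set.univ, isCompact_univ, subset_rfl⟩
  | @cons n R lo hi s ih =>
    obtain ⟨K, hK, hRK⟩ := ih
    obtain ⟨A, hA⟩ := (hK.image (continuous_ev n lo)).bddBelow
    obtain ⟨B, hB⟩ := (hK.image (continuous_ev n hi)).bddAbove
    have hc : Continuous fun y : (Fin n → ℝ) × ℝ => (Fin.snoc y.1 y.2 : Fin (n + 1) → ℝ) := by
      fun_prop
    refine ⟨_, (hK.prod (isCompact_Icc (a := A) (b := B))).image hc, ?_⟩
    rintro x ⟨h1, h2⟩
    have h2 := ivl_subset _ _ _ h2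
    refine ⟨(fun i => x i.castSucc, x (Fin.last n)), ⟨hRK h1, ?_, ?_⟩, ?_⟩
    · exact (hA ⟨_, hRK h1, rfl⟩).trans h2.1
    · exact h2.2.trans (hB ⟨_, hRK h1, rfl⟩)
    · exact Fin.snoc_init_self x

lemma integrableOn_rset {n : ℕ} (R : Reg n) {f : (Fin n → ℝ) → ℝ} (hf : Continuous f) :
    IntegrableOn f (rset R) := by
  obtain ⟨K, hK, h⟩ := bounded_rset R
  exact (hf.continuousOn.integrableOn_compact hK).mono_set h

theorem integral_rset {n : ℕ} (R : Reg n) (hR : valid R) (p : Pol n) (v : ℤ)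
    (hv : intAll R p = some v) :
    ∫ x in rset R, ev n p x = v / 360360 ^ n := by
  induction R generalizing v with
  | nil =>
    have hpv : p = v := Option.some.inj hv
    subst hpv
    rw [rset, Measure.restrict_univ, volume_pi, Measure.pi_of_empty]
    simp [ev]
  | @cons n R lo hi s ih =>
    have hm := measurableSet_rset (Reg.cons R lo hi s)
    have hint := integrableOn_rset (Reg.cons R lo hi s) (continuous_ev _ p)
    have hlen : List.length (p : List (Pol n)) ≤ 15 ∧
        intAll R (integ n p lo hi) = some v := by
      change (Bool.rec none (intAll R (integ n p lo hi))
        (Nat.ble (List.length (p : List (Pol n))) 15) : Option ℤ) = some v at hv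
      cases hb : Nat.ble (List.length (p : List (Pol n))) 15 with
      | false => rw [hb] at hv; cases hv
      | true => rw [hb] at hv; exact ⟨Nat.le_of_ble_eq_true hb, hv⟩
    have ih' := ih hR.1 (integ n p lo hi) v hlen.2
    have hsw : ∫ x in rset (Reg.cons R lo hi s), ev (n + 1) p x =
        ∫ x in rset R, (1 / 360360 : ℝ) * ev n (integ n p lo hi) x := ?_
    · rw [hsw, integral_const_mul, ih', pow_succ]
      ring
    clear ih' ih
    have e := (volume_preserving_piFinSuccAbove (fun _ : Fin (n+1) => ℝ) (Fin.last n)).symm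
    rw [← integral_indicator hm, ← e.integral_comp' , Measure.volume_eq_prod, integral_prod_symm,
      ← integral_indicator (measurableSet_rset R)]
    · congr 1
      funext y
      have key : ∀ t : ℝ, (MeasurableEquiv.piFinSuccAbove (fun _ => ℝ) (Fin.last n)).symm (t, y)
         = Fin.snoc y t := by
        intro t
        exact Fin.insertNth_last' t y
      simp only [key]
      by_cases hy : y ∈ rset R
      · rw [Set.indicator_of_mem hy, ev_integ _ _ _ _ _ hlen.1,
          show ∀ r : ℝ, (1 / 360360 : ℝ) * (360360 * r) = r by intro r; ring, ← setIntegral_ivl s _ _ (hR.2 y hy),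
          ← integral_indicator]
        · congr 1
          funext t
          have h1 : (Fin.snoc y t : Fin (n + 1) → ℝ) ∈ rset (Reg.cons R lo hi s) ↔
              t ∈ ivl s (ev n lo y) (ev n hi y) := by
            refine (mem_rset_cons R lo hi s _).trans ?_
            simp [hy]
          have h2 : ev (n + 1) p (Fin.snoc y t) = evalL (fun c => ev n c y) t p := by
            simp [ev]
          by_cases ht : t ∈ ivl s (ev n lo y) (ev n hi y)
          · rw [Set.indicator_of_mem ht, Set.indicator_of_mem (h1.2 ht), h2]
          · rw [Set.indicator_of_notMem ht, Set.indicator_of_notMem (fun h => ht (h1.1 h))]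
        · cases s
          · exact measurableSet_Icc
          · exact measurableSet_Ico
      · rw [Set.indicator_of_notMem hy]
        simp [Set.indicator, mem_rset_cons, hy]
    · have := (integrable_indicator_iff hm).2 hint
      exact e.integrable_comp_of_integrable this

end PolyInt

namespace PolyInt

/-- `q - ∑ xᵢ` over the listed indices. -/
def bd (q : ℤ) (n : ℕ) : List ℕ → Pol n
  | [] => pconst q n
  | i :: l => padd n (pscale (-1) n (pvar i n)) (bd q n l)

/-- The iterated region with given bounds for the variables 0, 1, 4, 5, 8, 9. -/
def reg (h0 : Pol 0) (h1 : Pol 1) (h4 : Pol 4) (s4 : Bool) (h5 : Pol 5) (s5 : Bool)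
    (l8 h8 : Pol 8) (s8 : Bool) (l9 h9 : Pol 9) (s9 : Bool) : Reg 10 :=
  .cons (.cons (.cons (.cons (.cons (.cons (.cons (.cons (.cons (.cons .nil
    (bd (-1) 0 []) h0 false)
    (bd (-1) 1 []) h1 false)
    (bd (-1) 2 []) (bd 2 2 [0, 1]) false)
    (bd (-1) 3 []) (bd 1 3 [0, 1, 2]) false)
    (bd (-1) 4 []) h4 s4)
    (bd (-1) 5 []) h5 s5)
    (bd (-1) 6 []) (bd 2 6 [4, 5]) false)
    (bd (-1) 7 []) (bd 1 7 [4, 5, 6]) false)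
    l8 h8 s8) l9 h9 s9

def rQ : Reg 10 := reg (bd 4 0 []) (bd 3 1 [0]) (bd 4 4 []) false (bd 3 5 [4]) false
  (bd (-1) 8 []) (bd 1 8 []) false (bd (-1) 9 []) (bd 1 9 []) false
def r10 : Reg 10 := reg (bd 1 0 []) (bd 3 1 [0]) (bd 0 4 [0]) false (bd 3 5 [4]) false
  (bd (-1) 8 []) (bd (-1) 8 [0, 4]) true (bd (-1) 9 []) (bd 1 9 []) false
def r20 : Reg 10 := reg (bd 0 0 []) (bd 3 1 [0]) (bd (-1) 4 [0]) true (bd 3 5 [4]) false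
  (bd (-1) 8 [0, 4]) (bd 1 8 []) false (bd (-1) 9 []) (bd 1 9 []) false
def r11 : Reg 10 := reg (bd 1 0 []) (bd 1 1 []) (bd 0 4 [0]) false (bd 0 5 [1]) false
  (bd (-1) 8 []) (bd (-1) 8 [0, 4]) true (bd (-1) 9 []) (bd (-1) 9 [1, 5]) true
def r12 : Reg 10 := reg (bd 1 0 []) (bd 0 1 []) (bd 0 4 [0]) false (bd (-1) 5 [1]) true
  (bd (-1) 8 []) (bd (-1) 8 [0, 4]) true (bd (-1) 9 [1, 5]) (bd 1 9 []) false
def r21 : Reg 10 := reg (bd 0 0 []) (bd 1 1 []) (bd (-1) 4 [0]) true (bd 0 5 [1]) false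
  (bd (-1) 8 [0, 4]) (bd 1 8 []) false (bd (-1) 9 []) (bd (-1) 9 [1, 5]) true
def r22 : Reg 10 := reg (bd 0 0 []) (bd 0 1 []) (bd (-1) 4 [0]) true (bd (-1) 5 [1]) true
  (bd (-1) 8 [0, 4]) (bd 1 8 []) false (bd (-1) 9 [1, 5]) (bd 1 9 []) false

/-- The combination of the region integrals that gives the integral over the polytope,
times `360360 ^ 10`. -/
def comb (f : Pol 10) : Option ℤ :=
  (intAll rQ f).bind fun a => (intAll r10 f).bind fun b => (intAll r20 f).bind fun c =>
  (intAll r11 f).bind fun d => (intAll r12 f).bind fun e => (intAll r21 f).bind fun g =>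
  (intAll r22 f).bind fun h => some (a - 2 * b - 2 * c + d + e + g + h)

def pO : Pol 10 := pconst 1 10
def pS : Pol 10 := padd 10 (pvar 0 10) (padd 10 (pvar 1 10) (padd 10 (pvar 4 10) (pvar 5 10)))
def pT : Pol 10 := padd 10 (pvar 2 10) (padd 10 (pvar 3 10) (padd 10 (pvar 6 10) (pvar 7 10)))
def pG : Pol 10 := padd 10 (pvar 8 10) (pvar 9 10)

lemma comb_O : comb pO =
    some (47229295276108650612128840547041747214128886821683200000000) := by decide +kernel
lemma comb_S : comb pS =
    some (36553093489921469849410653984654451054690186847846400000000) := by decide +kernel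
lemma comb_T : comb pT =
    some (-24368728993280979899607102656436300703126791231897600000000) := by decide +kernel
lemma comb_G : comb pG =
    some (8608640148990437895677577066386727572636630836838400000000) := by decide +kernel
lemma comb_SS : comb (pmul 10 pS pS) =
    some (92609504488411651799558961231751431424563044302848000000000) := by decide +kernel
lemma comb_ST : comb (pmul 10 pS pT) =
    some (-61739669658941101199705974154500954283042029535232000000000) := by decide +kernel
lemma comb_SG : comb (pmul 10 pS pG) =
    some (-220508923967361190915591479957508192370668884787200000000) := by decide +kernel
lemma comb_TT : comb (pmul 10 pT pT) =
    some (81556717525882197595841376601107047958739742067916800000000) := by decide +kernel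
lemma comb_TG : comb (pmul 10 pT pG) =
    some (147005949311574127277060986638338794913779256524800000000) := by decide +kernel
lemma comb_GG : comb (pmul 10 pG pG) =
    some (29979371836916800685142383155809966322815071870976000000000) := by decide +kernel
end PolyInt

namespace PolyInt

/-- The product of two simplices and a square. -/
def Q : Set (Fin 10 → ℝ) := {x | (-1 ≤ x 0 ∧ -1 ≤ x 1 ∧ -1 ≤ x 2 ∧ -1 ≤ x 3 ∧
  x 0 + x 1 + x 2 + x 3 ≤ 1) ∧ (-1 ≤ x 4 ∧ -1 ≤ x 5 ∧ -1 ≤ x 6 ∧ -1 ≤ x 7 ∧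
  x 4 + x 5 + x 6 + x 7 ≤ 1) ∧ (-1 ≤ x 8 ∧ x 8 ≤ 1) ∧ (-1 ≤ x 9 ∧ x 9 ≤ 1)}

def A1 : Set (Fin 10 → ℝ) := {x | x 0 + x 4 + x 8 < -1}
def A2 : Set (Fin 10 → ℝ) := {x | x 0 + x 4 < -1 ∧ -1 ≤ x 0 + x 4 + x 8}
def A0 : Set (Fin 10 → ℝ) := {x | -1 ≤ x 0 + x 4 ∧ -1 ≤ x 0 + x 4 + x 8}
def B1 : Set (Fin 10 → ℝ) := {x | x 1 + x 5 + x 9 < -1}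
def B2 : Set (Fin 10 → ℝ) := {x | x 1 + x 5 < -1 ∧ -1 ≤ x 1 + x 5 + x 9}
def B0 : Set (Fin 10 → ℝ) := {x | -1 ≤ x 1 + x 5 ∧ -1 ≤ x 1 + x 5 + x 9}

lemma mem_ivl_true (t a b : ℝ) : t ∈ ivl true a b ↔ a ≤ t ∧ t < b := Iff.rfl
lemma mem_ivl_false (t a b : ℝ) : t ∈ ivl false a b ↔ a ≤ t ∧ t ≤ b := Iff.rfl
lemma mem_nil (x : Fin 0 → ℝ) : x ∈ rset Reg.nil ↔ True := Iff.rfl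
lemma valid_cons {n : ℕ} (R : Reg n) (lo hi : Pol n) (s : Bool) :
    valid (Reg.cons R lo hi s) ↔ valid R ∧ ∀ x ∈ rset R, ev n lo x ≤ ev n hi x := Iff.rfl
lemma valid_nil : valid Reg.nil ↔ True := Iff.rfl

lemma ev_bd_nil (q : ℤ) (n : ℕ) (x : Fin n → ℝ) : ev n (bd q n []) x = q := ev_const q n x
lemma ev_bd_cons (q : ℤ) (n i : ℕ) (l : List ℕ) (x : Fin n → ℝ) :
    ev n (bd q n (i :: l)) x = -ev n (pvar i n) x + ev n (bd q n l) x := by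
  simp [bd]

set_option linter.unusedSimpArgs false

lemma rset_rQ : rset rQ = Q := by
  ext x
  simp only [rQ, reg, mem_rset_cons, mem_ivl_true, mem_ivl_false, ev_bd_nil, ev_bd_cons, mem_nil,
    Q, A1, A2, B1, B2, Set.mem_ofPred_eq, Set.mem_inter_iff]
  simp (discharger := omega) only [ev_var]
  simp only [Fin.castSucc_mk, Fin.reduceLast, Fin.reduceCastSucc, Fin.castSucc_zero, Fin.castSucc_one, Fin.reduceFinMk, Fin.mk_zero, Fin.mk_one, true_and,
    Int.cast_neg, Int.cast_one, Int.cast_ofNat, Int.cast_zero, Fin.isValue]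
  constructor <;> intro h <;> casesm* _ ∧ _ <;> and_intros <;> linarith

lemma valid_rQ : valid rQ := by
  simp only [rQ, reg, valid_cons, valid_nil, mem_rset_cons, mem_ivl_true, mem_ivl_false, ev_bd_nil,
    ev_bd_cons, mem_nil, true_and]
  simp (discharger := omega) only [ev_var]
  simp only [Fin.castSucc_mk, Fin.reduceLast, Fin.reduceCastSucc, Fin.castSucc_zero, Fin.castSucc_one, Fin.reduceFinMk, Fin.mk_zero, Fin.mk_one, true_and,
    Int.cast_neg, Int.cast_one, Int.cast_ofNat, Int.cast_zero, Fin.isValue]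
  and_intros <;> intros <;> (try casesm* _ ∧ _) <;> linarith

lemma rset_r10 : rset r10 = Q ∩ A1 := by
  ext x
  simp only [r10, reg, mem_rset_cons, mem_ivl_true, mem_ivl_false, ev_bd_nil, ev_bd_cons, mem_nil,
    Q, A1, A2, B1, B2, Set.mem_ofPred_eq, Set.mem_inter_iff]
  simp (discharger := omega) only [ev_var]
  simp only [Fin.castSucc_mk, Fin.reduceLast, Fin.reduceCastSucc, Fin.castSucc_zero, Fin.castSucc_one, Fin.reduceFinMk, Fin.mk_zero, Fin.mk_one, true_and,
    Int.cast_neg, Int.cast_one, Int.cast_ofNat, Int.cast_zero, Fin.isValue]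
  constructor <;> intro h <;> casesm* _ ∧ _ <;> and_intros <;> linarith

lemma valid_r10 : valid r10 := by
  simp only [r10, reg, valid_cons, valid_nil, mem_rset_cons, mem_ivl_true, mem_ivl_false, ev_bd_nil,
    ev_bd_cons, mem_nil, true_and]
  simp (discharger := omega) only [ev_var]
  simp only [Fin.castSucc_mk, Fin.reduceLast, Fin.reduceCastSucc, Fin.castSucc_zero, Fin.castSucc_one, Fin.reduceFinMk, Fin.mk_zero, Fin.mk_one, true_and,
    Int.cast_neg, Int.cast_one, Int.cast_ofNat, Int.cast_zero, Fin.isValue]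
  and_intros <;> intros <;> (try casesm* _ ∧ _) <;> linarith

lemma rset_r20 : rset r20 = Q ∩ A2 := by
  ext x
  simp only [r20, reg, mem_rset_cons, mem_ivl_true, mem_ivl_false, ev_bd_nil, ev_bd_cons, mem_nil,
    Q, A1, A2, B1, B2, Set.mem_ofPred_eq, Set.mem_inter_iff]
  simp (discharger := omega) only [ev_var]
  simp only [Fin.castSucc_mk, Fin.reduceLast, Fin.reduceCastSucc, Fin.castSucc_zero, Fin.castSucc_one, Fin.reduceFinMk, Fin.mk_zero, Fin.mk_one, true_and,
    Int.cast_neg, Int.cast_one, Int.cast_ofNat, Int.cast_zero, Fin.isValue]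
  constructor <;> intro h <;> casesm* _ ∧ _ <;> and_intros <;> linarith

lemma valid_r20 : valid r20 := by
  simp only [r20, reg, valid_cons, valid_nil, mem_rset_cons, mem_ivl_true, mem_ivl_false, ev_bd_nil,
    ev_bd_cons, mem_nil, true_and]
  simp (discharger := omega) only [ev_var]
  simp only [Fin.castSucc_mk, Fin.reduceLast, Fin.reduceCastSucc, Fin.castSucc_zero, Fin.castSucc_one, Fin.reduceFinMk, Fin.mk_zero, Fin.mk_one, true_and,
    Int.cast_neg, Int.cast_one, Int.cast_ofNat, Int.cast_zero, Fin.isValue]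
  and_intros <;> intros <;> (try casesm* _ ∧ _) <;> linarith

lemma rset_r11 : rset r11 = Q ∩ A1 ∩ B1 := by
  ext x
  simp only [r11, reg, mem_rset_cons, mem_ivl_true, mem_ivl_false, ev_bd_nil, ev_bd_cons, mem_nil,
    Q, A1, A2, B1, B2, Set.mem_ofPred_eq, Set.mem_inter_iff]
  simp (discharger := omega) only [ev_var]
  simp only [Fin.castSucc_mk, Fin.reduceLast, Fin.reduceCastSucc, Fin.castSucc_zero, Fin.castSucc_one, Fin.reduceFinMk, Fin.mk_zero, Fin.mk_one, true_and,
    Int.cast_neg, Int.cast_one, Int.cast_ofNat, Int.cast_zero, Fin.isValue]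
  constructor <;> intro h <;> casesm* _ ∧ _ <;> and_intros <;> linarith

lemma valid_r11 : valid r11 := by
  simp only [r11, reg, valid_cons, valid_nil, mem_rset_cons, mem_ivl_true, mem_ivl_false, ev_bd_nil,
    ev_bd_cons, mem_nil, true_and]
  simp (discharger := omega) only [ev_var]
  simp only [Fin.castSucc_mk, Fin.reduceLast, Fin.reduceCastSucc, Fin.castSucc_zero, Fin.castSucc_one, Fin.reduceFinMk, Fin.mk_zero, Fin.mk_one, true_and,
    Int.cast_neg, Int.cast_one, Int.cast_ofNat, Int.cast_zero, Fin.isValue]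
  and_intros <;> intros <;> (try casesm* _ ∧ _) <;> linarith

lemma rset_r12 : rset r12 = Q ∩ A1 ∩ B2 := by
  ext x
  simp only [r12, reg, mem_rset_cons, mem_ivl_true, mem_ivl_false, ev_bd_nil, ev_bd_cons, mem_nil,
    Q, A1, A2, B1, B2, Set.mem_ofPred_eq, Set.mem_inter_iff]
  simp (discharger := omega) only [ev_var]
  simp only [Fin.castSucc_mk, Fin.reduceLast, Fin.reduceCastSucc, Fin.castSucc_zero, Fin.castSucc_one, Fin.reduceFinMk, Fin.mk_zero, Fin.mk_one, true_and,
    Int.cast_neg, Int.cast_one, Int.cast_ofNat, Int.cast_zero, Fin.isValue]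
  constructor <;> intro h <;> casesm* _ ∧ _ <;> and_intros <;> linarith

lemma valid_r12 : valid r12 := by
  simp only [r12, reg, valid_cons, valid_nil, mem_rset_cons, mem_ivl_true, mem_ivl_false, ev_bd_nil,
    ev_bd_cons, mem_nil, true_and]
  simp (discharger := omega) only [ev_var]
  simp only [Fin.castSucc_mk, Fin.reduceLast, Fin.reduceCastSucc, Fin.castSucc_zero, Fin.castSucc_one, Fin.reduceFinMk, Fin.mk_zero, Fin.mk_one, true_and,
    Int.cast_neg, Int.cast_one, Int.cast_ofNat, Int.cast_zero, Fin.isValue]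
  and_intros <;> intros <;> (try casesm* _ ∧ _) <;> linarith

lemma rset_r21 : rset r21 = Q ∩ A2 ∩ B1 := by
  ext x
  simp only [r21, reg, mem_rset_cons, mem_ivl_true, mem_ivl_false, ev_bd_nil, ev_bd_cons, mem_nil,
    Q, A1, A2, B1, B2, Set.mem_ofPred_eq, Set.mem_inter_iff]
  simp (discharger := omega) only [ev_var]
  simp only [Fin.castSucc_mk, Fin.reduceLast, Fin.reduceCastSucc, Fin.castSucc_zero, Fin.castSucc_one, Fin.reduceFinMk, Fin.mk_zero, Fin.mk_one, true_and,
    Int.cast_neg, Int.cast_one, Int.cast_ofNat, Int.cast_zero, Fin.isValue]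
  constructor <;> intro h <;> casesm* _ ∧ _ <;> and_intros <;> linarith

lemma valid_r21 : valid r21 := by
  simp only [r21, reg, valid_cons, valid_nil, mem_rset_cons, mem_ivl_true, mem_ivl_false, ev_bd_nil,
    ev_bd_cons, mem_nil, true_and]
  simp (discharger := omega) only [ev_var]
  simp only [Fin.castSucc_mk, Fin.reduceLast, Fin.reduceCastSucc, Fin.castSucc_zero, Fin.castSucc_one, Fin.reduceFinMk, Fin.mk_zero, Fin.mk_one, true_and,
    Int.cast_neg, Int.cast_one, Int.cast_ofNat, Int.cast_zero, Fin.isValue]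
  and_intros <;> intros <;> (try casesm* _ ∧ _) <;> linarith

lemma rset_r22 : rset r22 = Q ∩ A2 ∩ B2 := by
  ext x
  simp only [r22, reg, mem_rset_cons, mem_ivl_true, mem_ivl_false, ev_bd_nil, ev_bd_cons, mem_nil,
    Q, A1, A2, B1, B2, Set.mem_ofPred_eq, Set.mem_inter_iff]
  simp (discharger := omega) only [ev_var]
  simp only [Fin.castSucc_mk, Fin.reduceLast, Fin.reduceCastSucc, Fin.castSucc_zero, Fin.castSucc_one, Fin.reduceFinMk, Fin.mk_zero, Fin.mk_one, true_and,
    Int.cast_neg, Int.cast_one, Int.cast_ofNat, Int.cast_zero, Fin.isValue]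
  constructor <;> intro h <;> casesm* _ ∧ _ <;> and_intros <;> linarith

lemma valid_r22 : valid r22 := by
  simp only [r22, reg, valid_cons, valid_nil, mem_rset_cons, mem_ivl_true, mem_ivl_false, ev_bd_nil,
    ev_bd_cons, mem_nil, true_and]
  simp (discharger := omega) only [ev_var]
  simp only [Fin.castSucc_mk, Fin.reduceLast, Fin.reduceCastSucc, Fin.castSucc_zero, Fin.castSucc_one, Fin.reduceFinMk, Fin.mk_zero, Fin.mk_one, true_and,
    Int.cast_neg, Int.cast_one, Int.cast_ofNat, Int.cast_zero, Fin.isValue]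
  and_intros <;> intros <;> (try casesm* _ ∧ _) <;> linarith


lemma integrableOn_Q {f : (Fin 10 → ℝ) → ℝ} (hf : Continuous f) {X : Set (Fin 10 → ℝ)}
    (hX : X ⊆ Q) : IntegrableOn f X :=
  (rset_rQ ▸ integrableOn_rset rQ hf).mono_set hX

lemma meas_A1 : MeasurableSet A1 := measurableSet_lt (by fun_prop) (by fun_prop)
lemma meas_A2 : MeasurableSet A2 := by
  unfold A2
  measurability
lemma meas_A0 : MeasurableSet A0 := by
  unfold A0
  measurability
lemma meas_B1 : MeasurableSet B1 := measurableSet_lt (by fun_prop) (by fun_prop)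
lemma meas_B2 : MeasurableSet B2 := by
  unfold B2
  measurability
lemma meas_B0 : MeasurableSet B0 := by
  unfold B0
  measurability
lemma meas_Q : MeasurableSet Q := rset_rQ ▸ measurableSet_rset rQ

lemma split3 {f : (Fin 10 → ℝ) → ℝ} {X U V W : Set (Fin 10 → ℝ)} (hf : IntegrableOn f X)
    (hX : MeasurableSet X)     (hV : MeasurableSet V) (hW : MeasurableSet W)
    (hU : U = (V ∪ W)ᶜ) (hVW : Disjoint V W) :
    ∫ x in X, f x = (∫ x in X ∩ U, f x) + (∫ x in X ∩ V, f x) + ∫ x in X ∩ W, f x := by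
  rw [← integral_inter_add_sdiff (hV.union hW) hf, Set.inter_union_distrib_left,
    setIntegral_union (hVW.mono Set.inter_subset_right Set.inter_subset_right)
      ?_ (hf.mono_set Set.inter_subset_left) (hf.mono_set Set.inter_subset_left), hU,
      Set.sdiff_eq]
  · ring
  · exact hX.inter hW

lemma A0_eq : A0 = (A1 ∪ A2)ᶜ := by
  ext x
  simp only [A0, A1, A2, Set.mem_ofPred_eq, Set.mem_compl_iff, Set.mem_union]
  grind
lemma B0_eq : B0 = (B1 ∪ B2)ᶜ := by
  ext x
  simp only [B0, B1, B2, Set.mem_ofPred_eq, Set.mem_compl_iff, Set.mem_union]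
  grind
lemma A_disj : Disjoint A1 A2 := by
  rw [Set.disjoint_left]
  intro x h1 h2
  exact absurd h2.2 (not_le.2 h1)
lemma B_disj : Disjoint B1 B2 := by
  rw [Set.disjoint_left]
  intro x h1 h2
  exact absurd h2.2 (not_le.2 h1)

/-- Integrals are invariant under permuting coordinates. -/
lemma perm_integral (σ : Equiv.Perm (Fin 10)) (X Y : Set (Fin 10 → ℝ))
    (hXY : ∀ x, x ∘ σ ∈ X ↔ x ∈ Y) (f : (Fin 10 → ℝ) → ℝ) :
    ∫ x in Y, f (x ∘ σ) = ∫ x in X, f x := by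
  have e := volume_preserving_arrowCongr' σ.symm (MeasurableEquiv.refl ℝ) (MeasurePreserving.id _)
  have h := e.setIntegral_preimage_emb (MeasurableEquiv.measurableEmbedding _) f X
  rw [← h]
  have : (MeasurableEquiv.arrowCongr' σ.symm (MeasurableEquiv.refl ℝ)) ⁻¹' X = Y := by
    ext x
    exact hXY x
  rw [this]
  rfl

/-- Exchanges the two triples `(0, 4, 8)` and `(1, 5, 9)`. -/
def s1 : Equiv.Perm (Fin 10) := Equiv.swap 0 1 * Equiv.swap 4 5 * Equiv.swap 8 9
/-- Exchanges the two simplices. -/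
def s2 : Equiv.Perm (Fin 10) :=
  Equiv.swap 0 4 * Equiv.swap 1 5 * Equiv.swap 2 6 * Equiv.swap 3 7
def s3 : Equiv.Perm (Fin 10) := Equiv.swap 2 3

lemma s1_vals : s1 0 = 1 ∧ s1 1 = 0 ∧ s1 2 = 2 ∧ s1 3 = 3 ∧ s1 4 = 5 ∧ s1 5 = 4 ∧ s1 6 = 6 ∧
    s1 7 = 7 ∧ s1 8 = 9 ∧ s1 9 = 8 := by decide
lemma s2_vals : s2 0 = 4 ∧ s2 1 = 5 ∧ s2 2 = 6 ∧ s2 3 = 7 ∧ s2 4 = 0 ∧ s2 5 = 1 ∧ s2 6 = 2 ∧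
    s2 7 = 3 ∧ s2 8 = 8 ∧ s2 9 = 9 := by decide
lemma s3_vals : s3 0 = 0 ∧ s3 1 = 1 ∧ s3 2 = 3 ∧ s3 3 = 2 ∧ s3 4 = 4 ∧ s3 5 = 5 ∧ s3 6 = 6 ∧
    s3 7 = 7 ∧ s3 8 = 8 ∧ s3 9 = 9 := by decide

/-- The polytope in coordinates. -/
def PP : Set (Fin 10 → ℝ) := Q ∩ A0 ∩ B0

theorem integral_PP (p : Pol 10) (v : ℤ) (hv : comb p = some v)
    (hs : ∀ x, ev 10 p (x ∘ s1) = ev 10 p x) :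
    ∫ x in PP, ev 10 p x = v / 360360 ^ 10 := by
  simp only [comb, Option.bind_eq_some_iff, Option.some.injEq] at hv
  obtain ⟨a, ha, b, hb, c, hc, d, hd, e, he, g, hg, h, hh, rfl⟩ := hv
  have ha := integral_rset _ valid_rQ _ _ ha
  have hb := integral_rset _ valid_r10 _ _ hb
  have hc := integral_rset _ valid_r20 _ _ hc
  have hd := integral_rset _ valid_r11 _ _ hd
  have he := integral_rset _ valid_r12 _ _ he
  have hg := integral_rset _ valid_r21 _ _ hg
  have hh := integral_rset _ valid_r22 _ _ hh
  rw [rset_rQ] at ha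
  rw [rset_r10] at hb
  rw [rset_r20] at hc
  rw [rset_r11] at hd
  rw [rset_r12] at he
  rw [rset_r21] at hg
  rw [rset_r22] at hh
  have hc0 := continuous_ev 10 p
  have hsym1 : ∫ x in Q ∩ B1, ev 10 p x = ∫ x in Q ∩ A1, ev 10 p x := by
    rw [← perm_integral s1 (Q ∩ A1) (Q ∩ B1)]
    · simp only [hs]
    · intro x
      simp only [Q, A1, B1, Set.mem_inter_iff, Set.mem_ofPred_eq, Function.comp, s1_vals]
      constructor <;> intro h <;> casesm* _ ∧ _ <;> and_intros <;> linarith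
  have hsym2 : ∫ x in Q ∩ B2, ev 10 p x = ∫ x in Q ∩ A2, ev 10 p x := by
    rw [← perm_integral s1 (Q ∩ A2) (Q ∩ B2)]
    · simp only [hs]
    · intro x
      simp only [Q, A2, B2, Set.mem_inter_iff, Set.mem_ofPred_eq, Function.comp, s1_vals]
      constructor <;> intro h <;> casesm* _ ∧ _ <;> and_intros <;> linarith
  have k1 := split3 (integrableOn_Q hc0 (X := Q) subset_rfl) meas_Q meas_A1 meas_A2 A0_eq A_disj
  have k2 := split3 (integrableOn_Q hc0 (X := Q ∩ A0) Set.inter_subset_left) (meas_Q.inter meas_A0) meas_B1 meas_B2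
    B0_eq B_disj
  have k3 := split3 (integrableOn_Q hc0 (X := Q ∩ B1) Set.inter_subset_left) (meas_Q.inter meas_B1) meas_A1 meas_A2
    A0_eq A_disj
  have k4 := split3 (integrableOn_Q hc0 (X := Q ∩ B2) Set.inter_subset_left) (meas_Q.inter meas_B2) meas_A1 meas_A2
    A0_eq A_disj
  simp only [Set.inter_right_comm Q B1, Set.inter_right_comm Q B2] at k3 k4
  have : ∫ x in PP, ev 10 p x = (a - 2 * b - 2 * c + d + e + g + h : ℝ) / 360360 ^ 10 := by
    simp only [PP]
    linear_combination -k1 - k2 + k3 + k4 + ha - 2 * hb - 2 * hc + hd + he + hg + hh - hsym1 - hsym2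
  rw [this]
  push_cast
  rfl
end PolyInt

namespace PolyInt

/-- The three symmetric linear forms. -/
def fS (x : Fin 10 → ℝ) : ℝ := x 0 + x 1 + x 4 + x 5
def fT (x : Fin 10 → ℝ) : ℝ := x 2 + x 3 + x 6 + x 7
def fG (x : Fin 10 → ℝ) : ℝ := x 8 + x 9

lemma ev_pO (x : Fin 10 → ℝ) : ev 10 pO x = 1 := by
  rw [pO, ev_const]; norm_num
lemma ev_pS (x : Fin 10 → ℝ) : ev 10 pS x = fS x := by
  simp (discharger := omega) only [pS, ev_add, ev_var, fS, Fin.reduceFinMk, Fin.mk_zero, Fin.mk_one,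
    Fin.isValue]
  simp only [add_assoc]
lemma ev_pT (x : Fin 10 → ℝ) : ev 10 pT x = fT x := by
  simp (discharger := omega) only [pT, ev_add, ev_var, fT, Fin.reduceFinMk, Fin.isValue]
  simp only [add_assoc]
lemma ev_pG (x : Fin 10 → ℝ) : ev 10 pG x = fG x := by
  simp (discharger := omega) only [pG, ev_add, ev_var, fG, Fin.reduceFinMk, Fin.isValue]

lemma fS_s1 (x : Fin 10 → ℝ) : fS (x ∘ s1) = fS x := by
  simp only [fS, Function.comp, s1_vals]; ring
lemma fT_s1 (x : Fin 10 → ℝ) : fT (x ∘ s1) = fT x := by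
  simp only [fT, Function.comp, s1_vals]
lemma fG_s1 (x : Fin 10 → ℝ) : fG (x ∘ s1) = fG x := by
  simp only [fG, Function.comp, s1_vals]; ring

lemma mom_O : ∫ _ in PP, (1 : ℝ) = 1160242379 / 907200 := by
  have h := integral_PP _ _ comb_O (fun x => by simp only [ev_pO])
  simp only [ev_pO] at h
  rw [h]; norm_num
lemma mom_S : ∫ x in PP, fS x = 74830759 / 75600 := by
  have h := integral_PP _ _ comb_S (fun x => by simp only [ev_pS, fS_s1])
  simp only [ev_pS] at h
  rw [h]; norm_num
lemma mom_T : ∫ x in PP, fT x = -74830759 / 113400 := by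
  have h := integral_PP _ _ comb_T (fun x => by simp only [ev_pT, fT_s1])
  simp only [ev_pT] at h
  rw [h]; norm_num
lemma mom_G : ∫ x in PP, fG x = 70493741 / 302400 := by
  have h := integral_PP _ _ comb_G (fun x => by simp only [ev_pG, fG_s1])
  simp only [ev_pG] at h
  rw [h]; norm_num
lemma mom_SS : ∫ x in PP, fS x * fS x = 10010263189 / 3991680 := by
  have h := integral_PP _ _ comb_SS (fun x => by simp only [ev_mul, ev_pS, fS_s1])
  simp only [ev_mul, ev_pS] at h
  rw [h]; norm_num
lemma mom_ST : ∫ x in PP, fS x * fT x = -10010263189 / 5987520 := by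
  have h := integral_PP _ _ comb_ST (fun x => by simp only [ev_mul, ev_pS, ev_pT, fS_s1, fT_s1])
  simp only [ev_mul, ev_pS, ev_pT] at h
  rw [h]; norm_num
lemma mom_SG : ∫ x in PP, fS x * fG x = -238350521 / 39916800 := by
  have h := integral_PP _ _ comb_SG (fun x => by simp only [ev_mul, ev_pS, ev_pG, fS_s1, fG_s1])
  simp only [ev_mul, ev_pS, ev_pG] at h
  rw [h]; norm_num
lemma mom_TT : ∫ x in PP, fT x * fT x = 18890475623 / 8553600 := by
  have h := integral_PP _ _ comb_TT (fun x => by simp only [ev_mul, ev_pT, fT_s1])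
  simp only [ev_mul, ev_pT] at h
  rw [h]; norm_num
lemma mom_TG : ∫ x in PP, fT x * fG x = 238350521 / 59875200 := by
  have h := integral_PP _ _ comb_TG (fun x => by simp only [ev_mul, ev_pT, ev_pG, fT_s1, fG_s1])
  simp only [ev_mul, ev_pT, ev_pG] at h
  rw [h]; norm_num
lemma mom_GG : ∫ x in PP, fG x * fG x = 19443019633 / 23950080 := by
  have h := integral_PP _ _ comb_GG (fun x => by simp only [ev_mul, ev_pG, fG_s1])
  simp only [ev_mul, ev_pG] at h
  rw [h]; norm_num

lemma meas_PP : MeasurableSet PP := (meas_Q.inter meas_A0).inter meas_B0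
lemma PP_sub : PP ⊆ Q := fun _ h => h.1.1
lemma int_PP {f : (Fin 10 → ℝ) → ℝ} (hf : Continuous f) : IntegrableOn f PP :=
  integrableOn_Q hf PP_sub

lemma PP_s1 (x : Fin 10 → ℝ) : x ∘ s1 ∈ PP ↔ x ∈ PP := by
  simp only [PP, Q, A0, B0, Set.mem_inter_iff, Set.mem_ofPred_eq, Function.comp, s1_vals]
  constructor <;> intro h <;> casesm* _ ∧ _ <;> and_intros <;> linarith
lemma PP_s2 (x : Fin 10 → ℝ) : x ∘ s2 ∈ PP ↔ x ∈ PP := by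
  simp only [PP, Q, A0, B0, Set.mem_inter_iff, Set.mem_ofPred_eq, Function.comp, s2_vals]
  constructor <;> intro h <;> casesm* _ ∧ _ <;> and_intros <;> linarith
lemma PP_s3 (x : Fin 10 → ℝ) : x ∘ s3 ∈ PP ↔ x ∈ PP := by
  simp only [PP, Q, A0, B0, Set.mem_inter_iff, Set.mem_ofPred_eq, Function.comp, s3_vals]
  constructor <;> intro h <;> casesm* _ ∧ _ <;> and_intros <;> linarith

lemma ball_sub : Metric.ball (0 : Fin 10 → ℝ) (1 / 10) ⊆ PP := by
  intro x hx
  have h : ∀ i, -(1 / 10) < x i ∧ x i < 1 / 10 := fun i => by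
    have h1 := (norm_le_pi_norm x i).trans_lt (mem_ball_zero_iff.1 hx)
    exact abs_lt.1 h1
  have h0 := h 0
  have h1 := h 1
  have h2 := h 2
  have h3 := h 3
  have h4 := h 4
  have h5 := h 5
  have h6 := h 6
  have h7 := h 7
  have h8 := h 8
  have h9 := h 9
  simp only [PP, Q, A0, B0, Set.mem_inter_iff, Set.mem_ofPred_eq]
  and_intros <;> linarith

/-- A linear form with vanishing second moment on the polytope is zero. -/
lemma form_zero (b : Fin 10 → ℝ) (h : ∫ x in PP, (∑ i, b i * x i) ^ 2 = 0) : b = 0 := by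
  have hc : Continuous fun x : Fin 10 → ℝ => (∑ i, b i * x i) ^ 2 := by fun_prop
  rw [setIntegral_eq_zero_iff_of_nonneg_ae (Filter.Eventually.of_forall fun x => sq_nonneg _)
    (int_PP hc)] at h
  have h2 : (fun x : Fin 10 → ℝ => (∑ i, b i * x i) ^ 2)
      =ᵐ[volume.restrict (Metric.ball (0 : Fin 10 → ℝ) (1 / 10))] 0 :=
    ae_restrict_of_ae_restrict_of_subset ball_sub h
  have h3 := Measure.eqOn_open_of_ae_eq h2 Metric.isOpen_ball hc.continuousOn continuousOn_const
  ext i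
  have hm : Pi.single i (1 / 20 : ℝ) ∈ Metric.ball (0 : Fin 10 → ℝ) (1 / 10) := by
    rw [mem_ball_zero_iff, Pi.norm_single]
    norm_num
  have h4 := h3 hm
  simpa [Pi.single_apply] using h4

lemma coef_sym (σ : Equiv.Perm (Fin 10)) (hσ : ∀ x, x ∘ σ ∈ PP ↔ x ∈ PP) (a : Fin 10 → ℝ) (c : ℝ)
    (hi : ∀ i, ∫ x in PP, x i * ((∑ j, a j * x j) + c) = ∫ x in PP, x i) (i : Fin 10) :
    a (σ i) = a i := by
  set b : Fin 10 → ℝ := fun i => a i - a (σ.symm i) with hb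
  have hd : ∀ x : Fin 10 → ℝ, ∑ i, b i * x i =
      ((∑ j, a j * x j) + c) - ((∑ j, a j * (x ∘ σ) j) + c) := by
    intro x
    have : ∑ j, a j * (x ∘ σ) j = ∑ j, a (σ.symm j) * x j := by
      rw [← Equiv.sum_comp σ (fun j => a (σ.symm j) * x j)]
      simp
    rw [this]
    simp only [hb, sub_mul, Finset.sum_sub_distrib]
    ring
  have h1 : ∀ i, ∫ x in PP, x i * ∑ j, b j * x j = 0 := by
    intro i
    simp only [hd, mul_sub]
    rw [integral_sub (int_PP (by fun_prop)) (int_PP (by fun_prop)), hi]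
    have e1 := perm_integral σ PP PP hσ
      (fun x => x (σ.symm i) * ((∑ j, a j * x j) + c))
    have e2 := perm_integral σ PP PP hσ (fun x => x (σ.symm i))
    simp only [Function.comp, Equiv.apply_symm_apply] at e1 e2
    simp only [Function.comp]
    rw [e1, e2, hi, sub_self]
  have h2 : ∫ x in PP, (∑ i, b i * x i) ^ 2 = 0 := by
    have : ∀ x : Fin 10 → ℝ, (∑ i, b i * x i) ^ 2 = ∑ i, b i * (x i * ∑ j, b j * x j) := by
      intro x
      rw [sq, Finset.sum_mul]
      exact Finset.sum_congr rfl fun i _ => by ring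
    simp only [this]
    rw [integral_finsetSum _ (fun i _ => int_PP (by fun_prop))]
    simp only [integral_const_mul, h1, mul_zero, Finset.sum_const_zero]
  have h3 := congrFun (form_zero b h2) (σ i)
  simp only [hb, Equiv.symm_apply_apply, Pi.zero_apply] at h3
  linarith

theorem main (a : Fin 10 → ℝ) (c : ℝ) (h0 : ∫ x in PP, ((∑ j, a j * x j) + c) = 0)
    (hi : ∀ i, ∫ x in PP, x i * ((∑ j, a j * x j) + c) = ∫ x in PP, x i) :
    ∀ x ∈ PP, ∑ j, a j * x j ≤ ∑ j, a j * (![-1, 4, -1, -1, 4, -1, -1, -1, 1, 1] : Fin 10 → ℝ) j := by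
  have c1 := coef_sym s1 PP_s1 a c hi
  have c2 := coef_sym s2 PP_s2 a c hi
  have c3 := coef_sym s3 PP_s3 a c hi
  have e1 := c1 0
  have e2 := c1 4
  have e3 := c2 0
  have e4 := c3 2
  have e5 := c2 2
  have e6 := c2 3
  have e7 := c1 8
  simp only [s1_vals, s2_vals, s3_vals] at e1 e2 e3 e4 e5 e6 e7
  have hlin : ∀ x : Fin 10 → ℝ, ∑ j, a j * x j = a 0 * fS x + a 2 * fT x + a 8 * fG x := by
    intro x
    simp only [Fin.sum_univ_succ, Fin.sum_univ_zero, Fin.succ_zero_eq_one, Fin.succ_one_eq_two,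
      Fin.reduceSucc, fS, fT, fG, e1, e2, e3, e4, e5, e6, e7]
    ring
  have cS : Continuous fS := by unfold fS; fun_prop
  have cT : Continuous fT := by unfold fT; fun_prop
  have cG : Continuous fG := by unfold fG; fun_prop
  have key : ∀ f : (Fin 10 → ℝ) → ℝ, Continuous f →
      ∫ x in PP, f x * ((∑ j, a j * x j) + c) = a 0 * (∫ x in PP, f x * fS x) +
        a 2 * (∫ x in PP, f x * fT x) + a 8 * (∫ x in PP, f x * fG x) + c * ∫ x in PP, f x := by
    intro f hf
    simp only [← integral_const_mul]
    rw [← integral_add (int_PP (by fun_prop)) (int_PP (by fun_prop)),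
      ← integral_add (int_PP (by fun_prop)) (int_PP (by fun_prop)),
      ← integral_add (int_PP (by fun_prop)) (int_PP (by fun_prop))]
    congr 1
    ext x
    rw [hlin]
    ring
  have q0 := key (fun _ => 1) continuous_const
  simp only [one_mul, h0, mom_S, mom_T, mom_G, mom_O] at q0
  have qS : ∫ x in PP, fS x * ((∑ j, a j * x j) + c) = ∫ x in PP, fS x := by
    simp only [fS, add_mul _ _ ((∑ j, a j * _) + c)]
    rw [integral_add (int_PP (by fun_prop)) (int_PP (by fun_prop)),
      integral_add (int_PP (by fun_prop)) (int_PP (by fun_prop)),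
      integral_add (int_PP (by fun_prop)) (int_PP (by fun_prop)),
      integral_add (int_PP (by fun_prop)) (int_PP (by fun_prop)),
      integral_add (int_PP (by fun_prop)) (int_PP (by fun_prop)),
      integral_add (int_PP (by fun_prop)) (int_PP (by fun_prop)), hi, hi, hi, hi]
  have qT : ∫ x in PP, fT x * ((∑ j, a j * x j) + c) = ∫ x in PP, fT x := by
    simp only [fT, add_mul _ _ ((∑ j, a j * _) + c)]
    rw [integral_add (int_PP (by fun_prop)) (int_PP (by fun_prop)),
      integral_add (int_PP (by fun_prop)) (int_PP (by fun_prop)),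
      integral_add (int_PP (by fun_prop)) (int_PP (by fun_prop)),
      integral_add (int_PP (by fun_prop)) (int_PP (by fun_prop)),
      integral_add (int_PP (by fun_prop)) (int_PP (by fun_prop)),
      integral_add (int_PP (by fun_prop)) (int_PP (by fun_prop)), hi, hi, hi, hi]
  have qG : ∫ x in PP, fG x * ((∑ j, a j * x j) + c) = ∫ x in PP, fG x := by
    simp only [fG, add_mul _ _ ((∑ j, a j * _) + c)]
    rw [integral_add (int_PP (by fun_prop)) (int_PP (by fun_prop)),
      integral_add (int_PP (by fun_prop)) (int_PP (by fun_prop)), hi, hi]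
  rw [key _ cS] at qS
  rw [key _ cT] at qT
  rw [key _ cG] at qG
  have mTS : ∫ x in PP, fT x * fS x = -10010263189 / 5987520 := by
    rw [← mom_ST]; simp only [mul_comm]
  have mGS : ∫ x in PP, fG x * fS x = -238350521 / 39916800 := by
    rw [← mom_SG]; simp only [mul_comm]
  have mGT : ∫ x in PP, fG x * fT x = 238350521 / 59875200 := by
    rw [← mom_TG]; simp only [mul_comm]
  simp only [mom_S, mom_T, mom_G, mom_SS, mom_ST, mom_SG, mom_TT, mom_TG, mom_GG, mTS, mGS, mGT]
    at qS qT qG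
  have hβ : a 2 = 0 := by linarith
  have hα : 0 ≤ a 0 := by linarith
  have hγ : 0 ≤ a 8 := by linarith
  intro x hx
  rw [hlin, hlin, hβ]
  have u : fS x ≤ fS ![-1, 4, -1, -1, 4, -1, -1, -1, 1, 1] := by
    simp only [PP, Q, A0, B0, Set.mem_inter_iff, Set.mem_ofPred_eq] at hx
    casesm* _ ∧ _
    simp [fS]
    linarith
  have w : fG x ≤ fG ![-1, 4, -1, -1, 4, -1, -1, -1, 1, 1] := by
    simp only [PP, Q, A0, B0, Set.mem_inter_iff, Set.mem_ofPred_eq] at hx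
    casesm* _ ∧ _
    simp [fG]
    linarith
  have := mul_le_mul_of_nonneg_left u hα
  have := mul_le_mul_of_nonneg_left w hγ
  linarith
end PolyInt


lemma P_eq : P = (@WithLp.ofLp 2 (Fin 10 → ℝ)) ⁻¹' PolyInt.PP := by
  ext x
  simp only [P, V18, ee, PolyInt.PP, PolyInt.Q, PolyInt.A0, PolyInt.B0, Set.mem_inter_iff,
    Set.mem_ofPred_eq, Set.mem_preimage, Set.mem_insert_iff, Set.mem_singleton_iff, forall_eq_or_imp,
    forall_eq, inner_add_right, inner_neg_right, EuclideanSpace.inner_single_right,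
    conj_trivial, one_mul, ge_iff_le]
  constructor <;> intro h <;> casesm* _ ∧ _ <;> and_intros <;> linarith

lemma P_integral (f : (Fin 10 → ℝ) → ℝ) :
    ∫ x in P, f (WithLp.ofLp x) = ∫ x in PolyInt.PP, f x := by
  rw [P_eq]
  exact (PiLp.volume_preserving_ofLp (Fin 10)).setIntegral_preimage_emb
    (MeasurableEquiv.toLp 2 (Fin 10 → ℝ)).symm.measurableEmbedding f PolyInt.PP

/-- Let `θ` be the (unique) affine function on `ℝ¹⁰` satisfying
`∫_P θ dx = 0` and `∫_P x_i·θ dx = ∫_P x_i dx` for all `i`.  Then `θ x ≤ θ v*` for every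
`x ∈ P`, i.e. the maximum of `θ` over `P` is attained at the vertex `v*`. -/
theorem stmt13 (θ : EuclideanSpace ℝ (Fin 10) → ℝ)
    (hθaff : ∃ (a : EuclideanSpace ℝ (Fin 10)) (c : ℝ), ∀ x, θ x = ⟪a, x⟫ + c)
    (hθ0 : (∫ x in P, θ x) = 0)
    (hθi : ∀ i : Fin 10, (∫ x in P, x i * θ x) = ∫ x in P, x i) :
    ∀ x ∈ P, θ x ≤ θ vstar := by
  obtain ⟨a, c, ha⟩ := hθaff
  have hθ : ∀ x, θ x = (∑ j, a j * x j) + c := by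
    intro x
    rw [ha, PiLp.inner_apply]
    simp [mul_comm]
  simp only [hθ] at hθ0 hθi ⊢
  have g0 := P_integral (fun x => (∑ j, a j * x j) + c)
  have h0 : ∫ x in PolyInt.PP, ((∑ j, a j * x j) + c) = 0 := g0.symm.trans hθ0
  have hi : ∀ i, ∫ x in PolyInt.PP, x i * ((∑ j, a j * x j) + c) = ∫ x in PolyInt.PP, x i :=
    fun i => (P_integral (fun x => x i * ((∑ j, a j * x j) + c))).symm.trans
      ((hθi i).trans (P_integral (fun x => x i)))
  intro x hx
  rw [P_eq] at hx
  have := PolyInt.main a c h0 hi _ hx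
  exact add_le_add this le_rfl
end
end

section
/- Let V ⊂ ℝ¹⁰ be the set of 18 points e₁, e₂, e₃, e₄, −(e₁+e₂+e₃+e₄), e₅, e₆, e₇, e₈, −(e₅+e₆+e₇+e₈), e₉, −e₉, e₁₀, −e₁₀, e₁+e₅, e₁+e₅+e₉, e₂+e₆, e₂+e₆+e₁₀, let P = {x ∈ ℝ¹⁰ : ⟨x, v⟩ ≥ −1 for every v ∈ V}, and let θ be the unique affine function on ℝ¹⁰ satisfying ∫_P θ(x) dx = 0 and ∫_P x_i·θ(x) dx = ∫_P x_i dx for i = 1, …, 10. Then θ(−1, 4, −1, −1, 4, −1, −1, −1, 1, 1) > 1. In particular the Mabuchi constant of the associated 10-dimensional toric Fano manifold exceeds 1. -/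
noncomputable section

open MeasureTheory
open scoped RealInnerProductSpace

set_option linter.unusedSectionVars false

/-- measurable and locally bounded -/
def LB {X : Type*} [NormedAddCommGroup X] [MeasurableSpace X] (f : X → ℝ) : Prop :=
  Measurable f ∧ ∀ R : ℝ, ∃ C : ℝ, ∀ x, ‖x‖ ≤ R → |f x| ≤ C

/-- measurable, locally bounded, with bounded support -/
def BS {X : Type*} [NormedAddCommGroup X] [MeasurableSpace X] (f : X → ℝ) : Prop :=
  LB f ∧ ∃ R : ℝ, ∀ x, f x ≠ 0 → ‖x‖ ≤ R

section
variable {X Y : Type*} [NormedAddCommGroup X] [MeasurableSpace X] [BorelSpace X] [ProperSpace X]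
  [NormedAddCommGroup Y] [MeasurableSpace Y] [BorelSpace Y]

theorem LB.mul {f g : X → ℝ} (hf : LB f) (hg : LB g) : LB (fun x => f x * g x) := by
  refine ⟨hf.1.mul hg.1, fun R => ?_⟩
  obtain ⟨C, hC⟩ := hf.2 R
  obtain ⟨D, hD⟩ := hg.2 R
  refine ⟨C * D, fun x hx => ?_⟩
  rw [abs_mul]
  exact mul_le_mul (hC x hx) (hD x hx) (abs_nonneg _) ((abs_nonneg _).trans (hC x hx))

theorem LB.const (c : ℝ) : LB (fun _ : X => c) :=
  ⟨measurable_const, fun _ => ⟨|c|, fun _ _ => le_rfl⟩⟩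

theorem LB.cont {f : X → ℝ} (hf : Continuous f) : LB f := by
  refine ⟨hf.measurable, fun R => ?_⟩
  obtain ⟨C, hC⟩ := (isCompact_closedBall (0 : X) R).exists_bound_of_continuousOn hf.continuousOn
  exact ⟨C, fun x hx => hC x (by simpa using hx)⟩

theorem LB.comp {g : Y → ℝ} {φ : X → Y} (hg : LB g) (hφ : Continuous φ) :
    LB (fun x => g (φ x)) := by
  refine ⟨hg.1.comp hφ.measurable, fun R => ?_⟩
  obtain ⟨C, hC⟩ := (isCompact_closedBall (0 : X) R).exists_bound_of_continuousOn hφ.continuousOn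
  obtain ⟨D, hD⟩ := hg.2 C
  exact ⟨D, fun x hx => hD _ (hC x (by simpa using hx))⟩

theorem LB.ite {p : X → Prop} [DecidablePred p] {f g : X → ℝ} (hp : MeasurableSet {x | p x})
    (hf : LB f) (hg : LB g) :
    LB (fun x => if p x then f x else g x) := by
  refine ⟨Measurable.ite hp hf.1 hg.1, fun R => ?_⟩
  obtain ⟨C, hC⟩ := hf.2 R
  obtain ⟨D, hD⟩ := hg.2 R
  refine ⟨max C D, fun x hx => ?_⟩
  beta_reduce
  split_ifs
  · exact (hC x hx).trans (le_max_left _ _)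
  · exact (hD x hx).trans (le_max_right _ _)

theorem BS.integrable {f : X → ℝ} (hf : BS f) (μ : Measure X)
    [IsFiniteMeasureOnCompacts μ] : Integrable f μ := by
  obtain ⟨⟨hm, hb⟩, R, hR⟩ := hf
  obtain ⟨C, hC⟩ := hb R
  rw [← integrableOn_iff_integrable_of_support_subset (s := Metric.closedBall 0 R)]
  · refine Measure.integrableOn_of_bounded (M := max C 0) ?_ hm.aestronglyMeasurable ?_
    · exact (isCompact_closedBall (0 : X) R).measure_lt_top.ne
    · refine Filter.Eventually.of_forall fun x => ?_
      by_cases h : ‖x‖ ≤ R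
      · exact (hC x h).trans (le_max_left _ _)
      · have : f x = 0 := by
          by_contra h0
          exact h (hR x h0)
        simp [this]
  · intro x hx
    simpa using hR x hx
end

theorem BS.slice {n : ℕ} {f : (Fin (n + 1) → ℝ) → ℝ} (hf : BS f) (t : ℝ) :
    BS (fun y : Fin n → ℝ => f (Matrix.vecCons t y)) := by
  obtain ⟨h1, R, hR⟩ := hf
  refine ⟨h1.comp ?_, max R 0, fun y hy => ?_⟩
  · exact Continuous.matrixVecCons continuous_const continuous_id
  · have := hR _ hy
    rw [pi_norm_le_iff_of_nonneg (le_max_right _ _)]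
    intro i
    have h2 := norm_le_pi_norm (Matrix.vecCons t y) i.succ
    simp at h2
    exact (h2.trans this).trans (le_max_left _ _)

theorem fub_succ {n : ℕ} {f : (Fin (n + 1) → ℝ) → ℝ} (hf : BS f) :
    ∫ x, f x = ∫ t : ℝ, ∫ y : Fin n → ℝ, f (Matrix.vecCons t y) := by
  have h := (volume_preserving_piFinSuccAbove (fun _ : Fin (n + 1) => ℝ) 0).symm
  have h2 := h.integral_comp (MeasurableEquiv.measurableEmbedding _) f
  rw [← h2]
  have h3 := (h.integrable_comp_emb (MeasurableEquiv.measurableEmbedding _) (g := f)).2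
    (hf.integrable _)
  rw [Measure.volume_eq_prod] at h3 ⊢
  refine (integral_prod _ h3).trans ?_
  simp [MeasurableEquiv.piFinSuccAbove_symm_apply, Fin.insertNthEquiv, Matrix.vecCons]

/-- iterated integrals -/
def iter : (n : ℕ) → ((Fin n → ℝ) → ℝ) → ℝ
  | 0, f => f ![]
  | n + 1, f => ∫ t : ℝ, iter n (fun y => f (Matrix.vecCons t y))

theorem fub_iter : ∀ (n : ℕ) {f : (Fin n → ℝ) → ℝ}, BS f → ∫ x, f x = iter n f
  | 0, f, hf => by
    rw [iter, Measure.volume_pi_eq_dirac ![]]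
    simp
  | n + 1, f, hf => by
    rw [fub_succ hf, iter]
    congr 1
    funext t
    exact fub_iter n (hf.slice t)

theorem perm_int {n : ℕ} (σ : Equiv.Perm (Fin n)) (f : (Fin n → ℝ) → ℝ) :
    ∫ y : Fin n → ℝ, f (fun i => y (σ i)) = ∫ y, f y := by
  have h := (volume_measurePreserving_piCongrLeft (fun _ : Fin n => ℝ) σ).symm
  have h2 := h.integral_comp (MeasurableEquiv.measurableEmbedding _) f
  rw [← h2]
  rfl

theorem int_ite_Icc {l r : ℝ} (h : l ≤ r) (f : ℝ → ℝ) :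
    ∫ x, (if l ≤ x ∧ x ≤ r then f x else 0) = ∫ x in l..r, f x := by
  rw [intervalIntegral.integral_of_le h, ← integral_Icc_eq_integral_Ioc,
    ← integral_indicator measurableSet_Icc]
  congr 1
  funext x
  simp [Set.indicator, Set.mem_Icc]

theorem int_ite_Ico {l r : ℝ} (h : l ≤ r) (f : ℝ → ℝ) :
    ∫ x, (if l ≤ x ∧ x < r then f x else 0) = ∫ x in l..r, f x := by
  rw [intervalIntegral.integral_of_le h, ← integral_Icc_eq_integral_Ioc,
    integral_Icc_eq_integral_Ico,
    ← integral_indicator measurableSet_Ico]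
  congr 1
  funext x
  simp [Set.indicator, Set.mem_Ico]

/-- indicator of the simplex -/
def sm (a b c d : ℝ) : ℝ :=
  if 0 ≤ a ∧ 0 ≤ b ∧ 0 ≤ c ∧ 0 ≤ d ∧ a + b + c + d ≤ 5 then 1 else 0

/-- area of the slices of the simplex -/
def om (a b : ℝ) : ℝ := if 0 ≤ a ∧ 0 ≤ b ∧ a + b ≤ 5 then (5 - a - b) ^ 2 / 2 else 0

theorem int_sm (a b : ℝ) : ∫ c, ∫ d, sm a b c d = om a b := by
  have h1 : ∀ c, ∫ d, sm a b c d =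
      if 0 ≤ a ∧ 0 ≤ b ∧ 0 ≤ c ∧ a + b + c ≤ 5 then 5 - a - b - c else 0 := by
    intro c
    split_ifs with h
    · have : ∀ d, sm a b c d = if 0 ≤ d ∧ d ≤ 5 - a - b - c then 1 else 0 := by
        intro d
        unfold sm
        congr 1
        simp only [h, true_and, eq_iff_iff]
        exact and_congr_right fun _ => ⟨fun h => by linarith, fun h => by linarith⟩
      simp_rw [this]
      rw [int_ite_Icc (by linarith)]
      simp
    · have : ∀ d, sm a b c d = 0 := by
        intro d
        unfold sm
        rw [if_neg]
        rintro ⟨h1, h2, h3, h4, h5⟩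
        exact h ⟨h1, h2, h3, by linarith⟩
      simp [this]
  simp_rw [h1]
  unfold om
  split_ifs with h
  · have : ∀ c, (if 0 ≤ a ∧ 0 ≤ b ∧ 0 ≤ c ∧ a + b + c ≤ 5 then 5 - a - b - c else 0) =
        if 0 ≤ c ∧ c ≤ 5 - a - b then (5 - a - b - c) else 0 := by
      intro c
      congr 1
      simp only [h, true_and, eq_iff_iff]
      exact and_congr_right fun _ => ⟨fun h => by linarith, fun h => by linarith⟩
    simp_rw [this]
    rw [int_ite_Icc (by linarith)]
    rw [intervalIntegral.integral_sub (by simp) (by simp)]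
    simp
    ring
  · refine integral_eq_zero_of_ae (Filter.Eventually.of_forall fun c => ?_)
    refine if_neg ?_
    rintro ⟨h1, h2, h3, h5⟩
    exact h ⟨h1, h2, by linarith⟩

/-- admissible weights -/
def Adm (u : ℝ → ℝ → ℝ) : Prop :=
  LB (fun z : ℝ × ℝ => u z.1 z.2) ∧ ∀ p s, u p s ≠ 0 → |s| ≤ 1

/-- the integrand -/
def J (u v : ℝ → ℝ → ℝ) (y : Fin 10 → ℝ) : ℝ :=
  sm (y 0) (y 2) (y 6) (y 7) * sm (y 1) (y 3) (y 8) (y 9) *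
    (u (y 0 + y 1) (y 4) * v (y 2 + y 3) (y 5))

theorem sm_LB : LB (fun z : Fin 4 → ℝ => sm (z 0) (z 1) (z 2) (z 3)) := by
  unfold sm
  refine LB.ite ?_ (LB.const _) (LB.const _)
  measurability

theorem sm_bd {a b c d : ℝ} (h : sm a b c d ≠ 0) :
    |a| ≤ 5 ∧ |b| ≤ 5 ∧ |c| ≤ 5 ∧ |d| ≤ 5 := by
  unfold sm at h
  split_ifs at h with h'
  · obtain ⟨h1, h2, h3, h4, h5⟩ := h'
    simp only [abs_le]
    refine ⟨⟨?_, ?_⟩, ⟨?_, ?_⟩, ⟨?_, ?_⟩, ⟨?_, ?_⟩⟩ <;> linarith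
  · exact absurd rfl h

theorem J_BS {u v : ℝ → ℝ → ℝ} (hu : Adm u) (hv : Adm v) : BS (J u v) := by
  constructor
  · refine LB.mul (LB.mul ?_ ?_) (LB.mul ?_ ?_)
    · exact sm_LB.comp (φ := fun y : Fin 10 → ℝ => ![y 0, y 2, y 6, y 7]) (by fun_prop)
    · exact sm_LB.comp (φ := fun y : Fin 10 → ℝ => ![y 1, y 3, y 8, y 9]) (by fun_prop)
    · exact hu.1.comp (φ := fun y : Fin 10 → ℝ => (y 0 + y 1, y 4)) (by fun_prop)
    · exact hv.1.comp (φ := fun y : Fin 10 → ℝ => (y 2 + y 3, y 5)) (by fun_prop)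
  · refine ⟨5, fun y hy => ?_⟩
    unfold J at hy
    simp only [mul_ne_zero_iff] at hy
    obtain ⟨⟨h1, h2⟩, h3, h4⟩ := hy
    have h1 := sm_bd h1
    have h2 := sm_bd h2
    have h3 := hu.2 _ _ h3
    have h4 := hv.2 _ _ h4
    rw [pi_norm_le_iff_of_nonneg (by norm_num)]
    intro i
    rw [Real.norm_eq_abs]
    fin_cases i <;> simp <;> linarith

theorem int_J {u v : ℝ → ℝ → ℝ} (hu : Adm u) (hv : Adm v) {U V : ℝ → ℝ}
    (hU : ∀ p, ∫ s, u p s = U p) (hV : ∀ p, ∫ s, v p s = V p) :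
    ∫ y, J u v y = ∫ a, ∫ b, ∫ a', ∫ b',
      om a a' * om b b' * (U (a + b) * V (a' + b')) := by
  rw [fub_iter _ (J_BS hu hv)]
  have h0 : ∀ a b a' b' s t e f g h : ℝ, J u v ![a, b, a', b', s, t, e, f, g, h] =
      sm a a' e f * sm b b' g h * (u (a + b) s * v (a' + b') t) := fun _ _ _ _ _ _ _ _ _ _ => rfl
  simp only [iter, h0, integral_const_mul, integral_mul_const, int_sm, hU, hV]

theorem sm_comm (a b c d : ℝ) : sm a b c d = sm b a c d := by
  unfold sm
  congr 1
  rw [add_comm a b, eq_iff_iff]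
  tauto

def sw : Equiv.Perm (Fin 10) := Equiv.swap 0 2 * Equiv.swap 1 3 * Equiv.swap 4 5

theorem J_swap (u v : ℝ → ℝ → ℝ) : ∫ y, J u v y = ∫ y, J v u y := by
  rw [← perm_int sw (J u v)]
  congr 1
  funext y
  unfold J
  have h0 : sw 0 = 2 := by decide
  have h1 : sw 1 = 3 := by decide
  have h2 : sw 2 = 0 := by decide
  have h3 : sw 3 = 1 := by decide
  have h4 : sw 4 = 5 := by decide
  have h5 : sw 5 = 4 := by decide
  have h6 : sw 6 = 6 := by decide
  have h7 : sw 7 = 7 := by decide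
  have h8 : sw 8 = 8 := by decide
  have h9 : sw 9 = 9 := by decide
  beta_reduce
  rw [h0, h1, h2, h3, h4, h5, h6, h7, h8, h9, sm_comm (y 2), sm_comm (y 3)]
  ring

/-- the weights: full and cut-off -/
def wb (i k : ℕ) (p s : ℝ) : ℝ := if -1 ≤ s ∧ s ≤ 1 then p ^ i * s ^ k else 0
def wd (i k : ℕ) (p s : ℝ) : ℝ :=
  if (-1 ≤ s ∧ s ≤ 1) ∧ (p < 1 ∨ p + s < 1) then p ^ i * s ^ k else 0

theorem wb_adm (i k : ℕ) : Adm (wb i k) := by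
  constructor
  · unfold wb
    refine LB.ite ?_ (LB.cont (by fun_prop)) (LB.const _)
    measurability
  · intro p s h
    unfold wb at h
    split_ifs at h with h'
    · exact abs_le.2 h'
    · exact absurd rfl h

theorem wd_adm (i k : ℕ) : Adm (wd i k) := by
  constructor
  · unfold wd
    refine LB.ite ?_ (LB.cont (by fun_prop)) (LB.const _)
    measurability
  · intro p s h
    unfold wd at h
    split_ifs at h with h'
    · exact abs_le.2 h'.1
    · exact absurd rfl h

def fk (k : ℕ) : ℝ := (1 - (-1) ^ (k + 1)) / (k + 1)
def G (k : ℕ) (p : ℝ) : ℝ :=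
  if p < 1 then fk k else if p < 2 then ((1 - p) ^ (k + 1) - (-1) ^ (k + 1)) / (k + 1) else 0

theorem int_wb (i k : ℕ) (p : ℝ) : ∫ s, wb i k p s = p ^ i * fk k := by
  unfold wb
  rw [int_ite_Icc (by norm_num)]
  simp [fk]

theorem int_wd (i k : ℕ) (p : ℝ) : ∫ s, wd i k p s = p ^ i * G k p := by
  unfold wd G
  split_ifs with h1 h2
  · rw [← int_wb]
    simp [wb, h1]
  · have : ∀ s, (if (-1 ≤ s ∧ s ≤ 1) ∧ (p < 1 ∨ p + s < 1) then p ^ i * s ^ k else 0) =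
        if -1 ≤ s ∧ s < 1 - p then p ^ i * s ^ k else 0 := by
      intro s
      congr 1
      simp only [h1, false_or, eq_iff_iff]
      constructor
      · rintro ⟨⟨h3, h4⟩, h5⟩
        exact ⟨h3, by linarith⟩
      · rintro ⟨h3, h5⟩
        exact ⟨⟨h3, by linarith⟩, by linarith⟩
    simp_rw [this]
    rw [int_ite_Ico (by linarith)]
    simp
  · rw [mul_zero]
    refine integral_eq_zero_of_ae (Filter.Eventually.of_forall fun s => ?_)
    refine if_neg ?_
    rintro ⟨⟨h3, h4⟩, h5 | h5⟩ <;> linarith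

theorem BS.mul_LB {X : Type*} [NormedAddCommGroup X] [MeasurableSpace X] [BorelSpace X]
    [ProperSpace X] {f g : X → ℝ} (hf : BS f) (hg : LB g) : BS (fun x => f x * g x) :=
  ⟨hf.1.mul hg, hf.2.imp fun _ h x hx => h x (left_ne_zero_of_mul hx)⟩

theorem nest {F : ℝ × ℝ → ℝ} (hF : BS F) : ∫ a, ∫ b, F (a, b) = ∫ z, F z := by
  have h := hF.integrable volume
  rw [Measure.volume_eq_prod] at h ⊢
  exact (integral_prod _ h).symm

/-- beta numbers -/
def be (m n : ℕ) : ℝ := (m.factorial * n.factorial : ℝ) / (m + n + 1).factorial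

theorem be_rec (m n : ℕ) : be m (n + 1) = be m n - be (m + 1) n := by
  unfold be
  have e1 : m + (n + 1) + 1 = (m + n + 1) + 1 := by ring
  have e2 : (m + 1) + n + 1 = (m + n + 1) + 1 := by ring
  rw [e1, e2, Nat.factorial_succ (m + n + 1), Nat.factorial_succ m, Nat.factorial_succ n]
  have : ((m + n + 1).factorial : ℝ) ≠ 0 := by positivity
  push_cast
  have h2 : (m + n + 1 + 1 : ℝ) ≠ 0 := by positivity
  field_simp
  ring

theorem int_beta (p : ℝ) (n : ℕ) : ∀ m : ℕ,
    ∫ a in (0 : ℝ)..p, a ^ m * (p - a) ^ n = be m n * p ^ (m + n + 1) := by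
  induction n with
  | zero =>
    intro m
    simp [be, Nat.factorial_succ]
    have : (m.factorial : ℝ) ≠ 0 := by positivity
    have h2 : (m + 1 : ℝ) ≠ 0 := by positivity
    field_simp
  | succ n ih =>
    intro m
    have h : ∀ a : ℝ, a ^ m * (p - a) ^ (n + 1) =
        p * (a ^ m * (p - a) ^ n) - a ^ (m + 1) * (p - a) ^ n := by
      intro a
      ring
    simp_rw [h]
    rw [intervalIntegral.integral_sub, intervalIntegral.integral_const_mul, ih, ih, be_rec]
    · ring
    · exact Continuous.intervalIntegrable (by fun_prop) _ _
    · exact Continuous.intervalIntegrable (by fun_prop) _ _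

theorem om_BS (a : ℝ) : BS (fun x => om a x) := by
  refine ⟨?_, 5 + |a|, ?_⟩
  · unfold om
    refine LB.ite ?_ (LB.cont (by fun_prop)) (LB.const _)
    measurability
  · intro x hx
    unfold om at hx
    beta_reduce at hx
    split_ifs at hx with h
    · obtain ⟨h1, h2, h3⟩ := h
      rw [Real.norm_eq_abs, abs_of_nonneg h2, abs_of_nonneg h1]
      linarith
    · exact absurd rfl hx

/-- moments of the slices -/
def ef (u : ℕ) (a : ℝ) : ℝ := if 0 ≤ a ∧ a ≤ 5 then be u 2 / 2 * (5 - a) ^ (u + 3) else 0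

theorem ef_BS (u : ℕ) : BS (ef u) := by
  refine ⟨?_, 5, ?_⟩
  · unfold ef
    refine LB.ite ?_ (LB.cont (by fun_prop)) (LB.const _)
    measurability
  · intro x hx
    unfold ef at hx
    split_ifs at hx with h
    · obtain ⟨h1, h2⟩ := h
      rw [Real.norm_eq_abs, abs_of_nonneg h1]
      linarith
    · exact absurd rfl hx

theorem int_om (u : ℕ) (a : ℝ) : ∫ x, om a x * x ^ u = ef u a := by
  unfold om ef
  split_ifs with h
  · have : ∀ x, (if 0 ≤ a ∧ 0 ≤ x ∧ a + x ≤ 5 then (5 - a - x) ^ 2 / 2 else 0) * x ^ u =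
        if 0 ≤ x ∧ x ≤ 5 - a then 1 / 2 * (x ^ u * (5 - a - x) ^ 2) else 0 := by
      intro x
      have e : (0 ≤ a ∧ 0 ≤ x ∧ a + x ≤ 5) ↔ (0 ≤ x ∧ x ≤ 5 - a) := by
        simp only [h, true_and]
        exact and_congr_right fun _ => ⟨fun h => by linarith, fun h => by linarith⟩
      simp only [e]
      split_ifs <;> ring
    simp_rw [this]
    rw [int_ite_Icc (by linarith), intervalIntegral.integral_const_mul, int_beta]
    ring
  · refine integral_eq_zero_of_ae (Filter.Eventually.of_forall fun x => ?_)
    beta_reduce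
    rw [if_neg, zero_mul]
    · rfl
    · rintro ⟨h1, h2, h3⟩
      exact h ⟨h1, by linarith⟩

theorem int_ef (u w : ℕ) : ∫ a, ef u a * a ^ w = be u 2 / 2 * (be w (u + 3) * 5 ^ (w + (u + 3) + 1)) := by
  unfold ef
  have : ∀ a : ℝ, (if 0 ≤ a ∧ a ≤ 5 then be u 2 / 2 * (5 - a) ^ (u + 3) else 0) * a ^ w =
      if 0 ≤ a ∧ a ≤ 5 then be u 2 / 2 * (a ^ w * (5 - a) ^ (u + 3)) else 0 := by
    intro a
    split_ifs <;> ring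
  simp_rw [this]
  rw [int_ite_Icc (by norm_num), intervalIntegral.integral_const_mul, int_beta]

/-- double binomial expansion -/
theorem int_binom {f g : ℝ → ℝ} (hf : BS f) (hg : BS g) (i : ℕ) :
    ∫ a, ∫ b, f a * g b * (a + b) ^ i =
      ∑ w ∈ Finset.range (i + 1), (i.choose w : ℝ) * ((∫ a, f a * a ^ w) * ∫ b, g b * b ^ (i - w)) := by
  have h1 : ∀ a b, f a * g b * (a + b) ^ i =
      ∑ w ∈ Finset.range (i + 1), (i.choose w * (f a * a ^ w)) * (g b * b ^ (i - w)) := by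
    intro a b
    rw [add_pow, Finset.mul_sum]
    refine Finset.sum_congr rfl fun w _ => ?_
    ring
  have I1 : ∀ n : ℕ, Integrable (fun b => g b * b ^ n) := fun n =>
    (hg.mul_LB (LB.cont (by fun_prop))).integrable _
  have I2 : ∀ n : ℕ, Integrable (fun b => f b * b ^ n) := fun n =>
    (hf.mul_LB (LB.cont (by fun_prop))).integrable _
  simp_rw [h1]
  have h2 : ∀ a, ∫ b, ∑ w ∈ Finset.range (i + 1), (i.choose w * (f a * a ^ w)) * (g b * b ^ (i - w)) =
      ∑ w ∈ Finset.range (i + 1), (i.choose w * (f a * a ^ w)) * ∫ b, (g b * b ^ (i - w)) := by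
    intro a
    rw [integral_finsetSum _ fun w _ => (I1 _).const_mul _]
    simp_rw [integral_const_mul]
  simp_rw [h2]
  rw [integral_finsetSum _ fun w _ => ((I2 _).const_mul _).mul_const _]
  simp_rw [integral_mul_const, integral_const_mul, mul_assoc]

theorem ef2_BS (u v : ℕ) : BS (fun z : ℝ × ℝ => ef u z.1 * ef v z.2) := by
  refine ⟨((ef_BS u).1.comp continuous_fst).mul ((ef_BS v).1.comp continuous_snd), ?_⟩
  refine ⟨5, fun z hz => ?_⟩
  obtain ⟨h1, h2⟩ := mul_ne_zero_iff.1 hz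
  have key : ∀ u a, ef u a ≠ 0 → ‖a‖ ≤ 5 := by
    intro u x hx
    unfold ef at hx
    split_ifs at hx with h
    · obtain ⟨h1, h2⟩ := h
      rw [Real.norm_eq_abs, abs_of_nonneg h1]
      linarith
    · exact absurd rfl hx
  exact norm_prod_le_iff.2 ⟨key _ _ h1, key _ _ h2⟩

/-- general form of the terms where only one pair is cut -/
theorem term12 {U : ℝ → ℝ} (hU : LB U) (c : ℝ) (j : ℕ) :
    ∫ a, ∫ b, ∫ a', ∫ b', om a a' * om b b' * (U (a + b) * ((a' + b') ^ j * c)) =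
      c * ∑ u ∈ Finset.range (j + 1), (j.choose u : ℝ) *
        ∫ z : ℝ × ℝ, ef u z.1 * ef (j - u) z.2 * U (z.1 + z.2) := by
  have h1 : ∀ a b, ∫ a', ∫ b', om a a' * om b b' * (U (a + b) * ((a' + b') ^ j * c)) =
      ∑ u ∈ Finset.range (j + 1), (c * j.choose u) * (ef u a * ef (j - u) b * U (a + b)) := by
    intro a b
    have e : ∀ a' b', om a a' * om b b' * (U (a + b) * ((a' + b') ^ j * c)) =
        (U (a + b) * c) * (om a a' * om b b' * (a' + b') ^ j) := by
      intro a' b'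
      ring
    simp_rw [e, integral_const_mul]
    rw [int_binom (om_BS a) (om_BS b)]
    simp_rw [int_om]
    rw [Finset.mul_sum]
    refine Finset.sum_congr rfl fun w _ => ?_
    ring
  simp_rw [h1]
  have B1 : ∀ u, BS (fun z : ℝ × ℝ => ef u z.1 * ef (j - u) z.2 * U (z.1 + z.2)) := fun u =>
    (ef2_BS u (j - u)).mul_LB (hU.comp (by fun_prop))
  have I : Integrable (fun z : ℝ × ℝ => ∑ u ∈ Finset.range (j + 1), (c * j.choose u) * (ef u z.1 * ef (j - u) z.2 * U (z.1 + z.2))) :=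
    integrable_finsetSum _ fun u _ => ((B1 u).integrable _).const_mul _
  rw [Measure.volume_eq_prod] at I
  refine (integral_prod _ I).symm.trans ?_
  rw [← Measure.volume_eq_prod, integral_finsetSum]
  · simp_rw [integral_const_mul, Finset.mul_sum, mul_assoc]
  · intro u _
    exact ((B1 u).integrable _).const_mul _

theorem term1 (u v i : ℕ) (c : ℝ) :
    ∫ z : ℝ × ℝ, ef u z.1 * ef v z.2 * ((z.1 + z.2) ^ i * c) =
    c * ∑ w ∈ Finset.range (i + 1), (i.choose w : ℝ) *
      ((be u 2 / 2 * (be w (u + 3) * 5 ^ (w + (u + 3) + 1))) *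
       (be v 2 / 2 * (be (i - w) (v + 3) * 5 ^ ((i - w) + (v + 3) + 1)))) := by
  rw [← nest (F := fun z : ℝ × ℝ => ef u z.1 * ef v z.2 * ((z.1 + z.2) ^ i * c))]
  · have e : ∀ a b, ef u a * ef v b * ((a + b) ^ i * c) = c * (ef u a * ef v b * (a + b) ^ i) := by
      intro a b
      ring
    simp_rw [e, integral_const_mul]
    rw [int_binom (ef_BS u) (ef_BS v)]
    simp_rw [int_ef]
  · exact (ef2_BS u v).mul_LB (LB.cont (by fun_prop))

/-- cut-off functions -/
def Cut (U : ℝ → ℝ) : Prop := LB U ∧ ∀ p, U p ≠ 0 → p < 2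

def tri (U : ℝ → ℝ) (z : ℝ × ℝ) : ℝ := if 0 ≤ z.1 ∧ 0 ≤ z.2 then U (z.1 + z.2) else 0

def gm (U : ℝ → ℝ) (N : ℕ) : ℝ := ∫ p, if 0 ≤ p then U p * p ^ N else 0

theorem tri_supp {U : ℝ → ℝ} (hU : Cut U) {z : ℝ × ℝ} (h : tri U z ≠ 0) :
    0 ≤ z.1 ∧ 0 ≤ z.2 ∧ z.1 + z.2 < 2 := by
  unfold tri at h
  split_ifs at h with h'
  · exact ⟨h'.1, h'.2, hU.2 _ h⟩
  · exact absurd rfl h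

theorem tri_BS {U : ℝ → ℝ} (hU : Cut U) : BS (tri U) := by
  refine ⟨?_, 2, fun z hz => ?_⟩
  · unfold tri
    refine LB.ite ?_ (hU.1.comp (by fun_prop)) (LB.const _)
    measurability
  · obtain ⟨h1, h2, h3⟩ := tri_supp hU hz
    refine norm_prod_le_iff.2 ⟨?_, ?_⟩ <;> rw [Real.norm_eq_abs, abs_of_nonneg (by assumption)] <;>
      linarith

theorem nu_eq {U : ℝ → ℝ} (hU : Cut U) (m n : ℕ) :
    ∫ z, tri U z * (z.1 ^ m * z.2 ^ n) = be m n * gm U (m + n + 1) := by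
  have hB : BS (fun z => tri U z * (z.1 ^ m * z.2 ^ n)) :=
    (tri_BS hU).mul_LB (LB.cont (by fun_prop))
  rw [← nest hB]
  have h1 : ∀ a, ∫ b, tri U (a, b) * (a ^ m * b ^ n) =
      ∫ p, tri U (a, p - a) * (a ^ m * (p - a) ^ n) := fun a =>
    (integral_sub_right_eq_self (fun b => tri U (a, b) * (a ^ m * b ^ n)) a).symm
  have hB2 : BS (fun z : ℝ × ℝ => tri U (z.1, z.2 - z.1) * (z.1 ^ m * (z.2 - z.1) ^ n)) := by
    refine ⟨hB.1.comp (φ := fun z : ℝ × ℝ => (z.1, z.2 - z.1)) (by fun_prop), 2, fun z hz => ?_⟩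
    obtain ⟨h1, h2, h3⟩ := tri_supp hU (left_ne_zero_of_mul hz)
    simp only at h1 h2 h3
    refine norm_prod_le_iff.2 ⟨?_, ?_⟩
    · rw [Real.norm_eq_abs, abs_of_nonneg h1]
      linarith
    · rw [Real.norm_eq_abs, abs_of_nonneg (by linarith)]
      linarith
  simp_rw [h1]
  have I := hB2.integrable volume
  rw [Measure.volume_eq_prod] at I
  rw [integral_integral_swap (f := fun a p => tri U (a, p - a) * (a ^ m * (p - a) ^ n)) I]
  unfold gm
  rw [← integral_const_mul]
  congr 1
  funext p
  split_ifs with hp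
  · have : ∀ a, tri U (a, p - a) * (a ^ m * (p - a) ^ n) =
        if 0 ≤ a ∧ a ≤ p then U p * (a ^ m * (p - a) ^ n) else 0 := by
      intro a
      unfold tri
      simp only [sub_nonneg, add_sub_cancel, ite_mul, zero_mul]
    simp_rw [this]
    rw [int_ite_Icc hp, intervalIntegral.integral_const_mul, int_beta]
    ring
  · rw [mul_zero]
    refine integral_eq_zero_of_ae (Filter.Eventually.of_forall fun a => ?_)
    unfold tri
    beta_reduce
    rw [if_neg, zero_mul]
    · rfl
    · rintro ⟨h1, h2⟩
      simp only at h1 h2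
      linarith

/-- shifted moments, expanded -/
def sh (U : ℝ → ℝ) (R S : ℝ) (m n : ℕ) : ℝ :=
  ∑ u ∈ Finset.range (m + 1), ∑ v ∈ Finset.range (n + 1),
    ((-1) ^ (u + v) * m.choose u * n.choose v * R ^ (m - u) * S ^ (n - v)) *
      (be u v * gm U (u + v + 1))

theorem nur_eq {U : ℝ → ℝ} (hU : Cut U) (R S : ℝ) (m n : ℕ) :
    ∫ z, tri U z * ((R - z.1) ^ m * (S - z.2) ^ n) = sh U R S m n := by
  have h1 : ∀ z : ℝ × ℝ, tri U z * ((R - z.1) ^ m * (S - z.2) ^ n) =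
      ∑ u ∈ Finset.range (m + 1), ∑ v ∈ Finset.range (n + 1),
      ((-1) ^ (u + v) * m.choose u * n.choose v * R ^ (m - u) * S ^ (n - v)) *
        (tri U z * (z.1 ^ u * z.2 ^ v)) := by
    intro z
    rw [show R - z.1 = -z.1 + R by ring, show S - z.2 = -z.2 + S by ring, add_pow, add_pow,
      Finset.sum_mul_sum, Finset.mul_sum]
    refine Finset.sum_congr rfl fun u _ => ?_
    rw [Finset.mul_sum]
    refine Finset.sum_congr rfl fun v _ => ?_
    rw [neg_pow z.1, neg_pow z.2]
    ring
  simp_rw [h1]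
  have I : ∀ u v : ℕ, Integrable (fun z => tri U z * (z.1 ^ u * z.2 ^ v)) := fun u v =>
    ((tri_BS hU).mul_LB (LB.cont (by fun_prop))).integrable _
  rw [integral_finsetSum _ fun u _ => integrable_finsetSum _ fun v _ => (I u v).const_mul _]
  refine Finset.sum_congr rfl fun u _ => ?_
  rw [integral_finsetSum _ fun v _ => (I u v).const_mul _]
  refine Finset.sum_congr rfl fun v _ => ?_
  rw [integral_const_mul, nu_eq hU]

theorem term2 {U : ℝ → ℝ} (hU : Cut U) (u v : ℕ) :
    ∫ z : ℝ × ℝ, ef u z.1 * ef v z.2 * U (z.1 + z.2) =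
      (be u 2 / 2) * (be v 2 / 2) * sh U 5 5 (u + 3) (v + 3) := by
  rw [← nur_eq hU, ← integral_const_mul]
  congr 1
  funext z
  unfold ef tri
  by_cases h0 : U (z.1 + z.2) = 0
  · simp [h0]
  have h2 := hU.2 _ h0
  by_cases h : 0 ≤ z.1 ∧ 0 ≤ z.2
  · rw [if_pos ⟨h.1, by linarith⟩, if_pos ⟨h.2, by linarith⟩, if_pos h]
    ring
  · rw [if_neg h]
    by_cases h3 : 0 ≤ z.1
    · have h4 : ¬ (0 ≤ z.2 ∧ z.2 ≤ 5) := fun h5 => h ⟨h3, h5.1⟩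
      rw [if_neg h4]
      simp
    · have h4 : ¬ (0 ≤ z.1 ∧ z.1 ≤ 5) := fun h5 => h3 h5.1
      rw [if_neg h4]
      simp

theorem term4 {U V : ℝ → ℝ} (hU : Cut U) (hV : Cut V) :
    ∫ a, ∫ b, ∫ a', ∫ b', om a a' * om b b' * (U (a + b) * V (a' + b')) =
      1 / 4 * ∑ u ∈ Finset.range 3, ∑ v ∈ Finset.range 3,
        ((-1) ^ (u + v) * (Nat.choose 2 u) * (Nat.choose 2 v)) * (be u v * gm V (u + v + 1)) *
          sh U 5 5 (2 - u) (2 - v) := by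
  have h1 : ∀ a b, ∫ a', ∫ b', om a a' * om b b' * (U (a + b) * V (a' + b')) =
      1 / 4 * ∑ u ∈ Finset.range 3, ∑ v ∈ Finset.range 3,
        ((-1) ^ (u + v) * (Nat.choose 2 u) * (Nat.choose 2 v)) * (be u v * gm V (u + v + 1)) *
         (tri U (a, b) * ((5 - a) ^ (2 - u) * (5 - b) ^ (2 - v))) := by
    intro a b
    have e : ∀ a' b', om a a' * om b b' * (U (a + b) * V (a' + b')) =
        tri U (a, b) / 4 * (tri V (a', b') * ((5 - a - a') ^ 2 * (5 - b - b') ^ 2)) := by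
      intro a' b'
      by_cases hu : U (a + b) = 0
      · simp [tri, hu]
      by_cases hv : V (a' + b') = 0
      · simp [tri, hv]
      have h1 := hU.2 _ hu
      have h2 := hV.2 _ hv
      unfold om tri
      simp only
      by_cases k1 : 0 ≤ a
      · by_cases k2 : 0 ≤ b
        · by_cases k3 : 0 ≤ a'
          · by_cases k4 : 0 ≤ b'
            · rw [if_pos ⟨k1, k3, by linarith⟩, if_pos ⟨k2, k4, by linarith⟩,
                if_pos ⟨k1, k2⟩, if_pos ⟨k3, k4⟩]
              ring
            · simp [k4]
          · simp [k3]
        · simp [k2]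
      · simp [k1]
    have hB : BS (fun z : ℝ × ℝ => tri V z * ((5 - a - z.1) ^ 2 * (5 - b - z.2) ^ 2)) :=
      (tri_BS hV).mul_LB (LB.cont (by fun_prop))
    simp_rw [e, integral_const_mul]
    rw [nest hB, nur_eq hV]
    unfold sh
    rw [Finset.mul_sum, Finset.mul_sum]
    refine Finset.sum_congr rfl fun u _ => ?_
    rw [Finset.mul_sum, Finset.mul_sum]
    refine Finset.sum_congr rfl fun v _ => ?_
    ring
  simp_rw [h1, integral_const_mul]
  congr 1
  have I : ∀ u v : ℕ, Integrable (fun z : ℝ × ℝ => tri U z * ((5 - z.1) ^ u * (5 - z.2) ^ v)) :=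
    fun u v => ((tri_BS hU).mul_LB (LB.cont (by fun_prop))).integrable _
  have I1 : ∀ u : ℕ, Integrable (fun z : ℝ × ℝ => ∑ v ∈ Finset.range 3,
        ((-1) ^ (u + v) * (Nat.choose 2 u) * (Nat.choose 2 v)) * (be u v * gm V (u + v + 1)) *
         (tri U z * ((5 - z.1) ^ (2 - u) * (5 - z.2) ^ (2 - v)))) := fun u =>
    integrable_finsetSum _ fun v _ => (I _ _).const_mul _
  have I2 : Integrable (fun z : ℝ × ℝ => ∑ u ∈ Finset.range 3, ∑ v ∈ Finset.range 3,
        ((-1) ^ (u + v) * (Nat.choose 2 u) * (Nat.choose 2 v)) * (be u v * gm V (u + v + 1)) *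
         (tri U z * ((5 - z.1) ^ (2 - u) * (5 - z.2) ^ (2 - v)))) :=
    integrable_finsetSum _ fun u _ => I1 u
  rw [Measure.volume_eq_prod] at I2
  refine (integral_prod _ I2).symm.trans ?_
  rw [← Measure.volume_eq_prod, integral_finsetSum _ fun u _ => I1 u]
  refine Finset.sum_congr rfl fun u _ => ?_
  rw [integral_finsetSum _ fun v _ => (I _ _).const_mul _]
  refine Finset.sum_congr rfl fun v _ => ?_
  rw [integral_const_mul, nur_eq hU]

/-- the cut-off function with polynomial weight -/
def UG (i k : ℕ) (p : ℝ) : ℝ := p ^ i * G k p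

theorem UG_cut (i k : ℕ) : Cut (UG i k) := by
  constructor
  · unfold UG G
    refine LB.mul (LB.cont (by fun_prop)) (LB.ite ?_ (LB.const _)
      (LB.ite ?_ (LB.cont (by fun_prop)) (LB.const _)))
    all_goals measurability
  · intro p hp
    unfold UG G at hp
    by_contra h
    rw [if_neg (by linarith), if_neg h] at hp
    simp at hp

/-- moments of the cut-off functions -/
def gk (k N : ℕ) : ℝ := fk k / (N + 1) + 1 / (k + 1) *
  ((∑ u ∈ Finset.range (k + 2), (-1 : ℝ) ^ u * ((k + 1).choose u : ℝ) * ((2 ^ (N + u + 1) - 1) / (N + u + 1)))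
    - (-1) ^ (k + 1) * ((2 ^ (N + 1) - 1) / (N + 1)))

theorem gm_UG (i k N : ℕ) : gm (UG i k) N = gk k (i + N) := by
  have h1 : ∀ p : ℝ, (if 0 ≤ p then UG i k p * p ^ N else 0) =
      (if 0 ≤ p ∧ p < 1 then fk k * p ^ (i + N) else 0) +
      (if 1 ≤ p ∧ p < 2 then 1 / (k + 1) *
        ((∑ u ∈ Finset.range (k + 2), (-1) ^ u * (k + 1).choose u * p ^ (i + N + u)) -
          (-1) ^ (k + 1) * p ^ (i + N)) else 0) := by
    intro p
    have e : (∑ u ∈ Finset.range (k + 2), (-1) ^ u * ((k + 1).choose u : ℝ) * p ^ (i + N + u)) =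
        p ^ (i + N) * (1 - p) ^ (k + 1) := by
      rw [show 1 - p = -p + 1 by ring, add_pow, Finset.mul_sum]
      refine Finset.sum_congr rfl fun u _ => ?_
      rw [neg_pow]
      ring
    rw [e]
    unfold UG G
    by_cases h0 : 0 ≤ p
    · by_cases h1 : p < 1
      · rw [if_pos h0, if_pos h1, if_pos ⟨h0, h1⟩, if_neg (fun h => absurd h.1 (by linarith))]
        ring
      · by_cases h2 : p < 2
        · rw [if_pos h0, if_neg h1, if_pos h2, if_neg (fun h => h1 h.2), if_pos ⟨by linarith, h2⟩]
          ring
        · rw [if_pos h0, if_neg h1, if_neg h2, if_neg (fun h => h1 h.2), if_neg (fun h => h2 h.2)]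
          ring
    · rw [if_neg h0, if_neg (fun h => h0 h.1), if_neg (fun h => h0 (by linarith [h.1]))]
      ring
  unfold gm
  simp_rw [h1]
  rw [integral_add, int_ite_Ico (by norm_num), int_ite_Ico (by norm_num)]
  · rw [intervalIntegral.integral_const_mul, intervalIntegral.integral_const_mul,
      intervalIntegral.integral_sub, intervalIntegral.integral_const_mul,
      intervalIntegral.integral_finsetSum]
    · simp_rw [intervalIntegral.integral_const_mul, integral_pow]
      unfold gk
      push_cast
      simp
      ring
    · intro u _
      exact Continuous.intervalIntegrable (by fun_prop) _ _
    · exact Continuous.intervalIntegrable (by fun_prop) _ _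
    · exact Continuous.intervalIntegrable (by fun_prop) _ _
  · refine BS.integrable ⟨LB.ite ?_ (LB.cont (by fun_prop)) (LB.const _), 2, fun p hp => ?_⟩ _
    · measurability
    · beta_reduce at hp
      split_ifs at hp with h
      · rw [Real.norm_eq_abs, abs_of_nonneg h.1]
        linarith
      · exact absurd rfl hp
  · refine BS.integrable ⟨LB.ite ?_ (LB.cont (by fun_prop)) (LB.const _), 2, fun p hp => ?_⟩ _
    · measurability
    · beta_reduce at hp
      split_ifs at hp with h
      · rw [Real.norm_eq_abs, abs_of_nonneg (by linarith)]
        linarith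
      · exact absurd rfl hp

/-- weight on the polytope -/
def wx (i k : ℕ) (p s : ℝ) : ℝ := wb i k p s - wd i k p s

def N1 (i k j l : ℕ) : ℝ := fk k * fk l * ∑ u ∈ Finset.range (j + 1), (j.choose u : ℝ) *
    ∑ w ∈ Finset.range (i + 1), (i.choose w : ℝ) *
      ((be u 2 / 2 * (be w (u + 3) * 5 ^ (w + (u + 3) + 1))) *
       (be (j - u) 2 / 2 * (be (i - w) ((j - u) + 3) * 5 ^ ((i - w) + ((j - u) + 3) + 1))))

/-- shifted moments, numerically -/
def shN (i k m n : ℕ) : ℝ :=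
  ∑ u ∈ Finset.range (m + 1), ∑ v ∈ Finset.range (n + 1),
    ((-1) ^ (u + v) * m.choose u * n.choose v * 5 ^ (m - u) * 5 ^ (n - v)) *
      (be u v * gk k (i + (u + v + 1)))

theorem sh_UG (i k m n : ℕ) : sh (UG i k) 5 5 m n = shN i k m n := by
  unfold sh shN
  simp_rw [gm_UG]

def N2 (i k j l : ℕ) : ℝ := fk l * ∑ u ∈ Finset.range (j + 1), (j.choose u : ℝ) *
    ((be u 2 / 2) * (be (j - u) 2 / 2) * shN i k (u + 3) (j - u + 3))

def N4 (i k j l : ℕ) : ℝ := 1 / 4 * ∑ u ∈ Finset.range 3, ∑ v ∈ Finset.range 3,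
        ((-1) ^ (u + v) * (Nat.choose 2 u) * (Nat.choose 2 v)) *
          (be u v * gk l (j + (u + v + 1))) * shN i k (2 - u) (2 - v)

theorem J_bb (i k j l : ℕ) : ∫ y, J (wb i k) (wb j l) y = N1 i k j l := by
  rw [int_J (wb_adm i k) (wb_adm j l) (int_wb i k) (int_wb j l)]
  rw [term12 (U := fun p => p ^ i * fk k) (LB.cont (by fun_prop))]
  simp_rw [term1]
  unfold N1
  simp only [Finset.mul_sum]
  refine Finset.sum_congr rfl fun u _ => Finset.sum_congr rfl fun w _ => ?_
  ring

theorem J_db (i k j l : ℕ) : ∫ y, J (wd i k) (wb j l) y = N2 i k j l := by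
  rw [int_J (wd_adm i k) (wb_adm j l) (int_wd i k) (int_wb j l)]
  rw [term12 (U := fun p => p ^ i * G k p) (UG_cut i k).1]
  unfold N2
  congr 1
  refine Finset.sum_congr rfl fun u _ => ?_
  congr 1
  rw [← sh_UG, ← term2 (UG_cut i k)]
  rfl

theorem J_bd (i k j l : ℕ) : ∫ y, J (wb i k) (wd j l) y = N2 j l i k := by
  rw [J_swap, J_db]

theorem J_dd (i k j l : ℕ) : ∫ y, J (wd i k) (wd j l) y = N4 i k j l := by
  rw [int_J (wd_adm i k) (wd_adm j l) (int_wd i k) (int_wd j l)]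
  have := term4 (UG_cut i k) (UG_cut j l)
  unfold N4
  simp_rw [sh_UG, gm_UG] at this
  exact this

theorem J_xx (i k j l : ℕ) : ∫ y, J (wx i k) (wx j l) y =
    N1 i k j l - N2 i k j l - N2 j l i k + N4 i k j l := by
  have h : ∀ y, J (wx i k) (wx j l) y = J (wb i k) (wb j l) y - J (wd i k) (wb j l) y
      - J (wb i k) (wd j l) y + J (wd i k) (wd j l) y := by
    intro y
    unfold J wx
    ring
  have I1 := (J_BS (wb_adm i k) (wb_adm j l)).integrable volume
  have I2 := (J_BS (wd_adm i k) (wb_adm j l)).integrable volume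
  have I3 := (J_BS (wb_adm i k) (wd_adm j l)).integrable volume
  have I4 := (J_BS (wd_adm i k) (wd_adm j l)).integrable volume
  simp_rw [h]
  have e1 := integral_add ((I1.sub I2).sub I3) I4
  have e2 := integral_sub (I1.sub I2) I3
  have e3 := integral_sub I1 I2
  simp only [Pi.sub_apply] at e1 e2 e3
  rw [e1, e2, e3, J_bb, J_db, J_bd, J_dd]

theorem gk_tab0 : gk 0 1 = 5/3 ∧
    gk 0 2 = 19/12 ∧
    gk 0 3 = 9/5 ∧
    gk 0 4 = 23/10 ∧
    gk 0 5 = 67/21 ∧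
    gk 0 6 = 263/56 ∧
    gk 0 7 = 65/9 ∧
    gk 0 8 = 1033/90 ∧
    gk 0 9 = 1029/55 := by
  norm_num [fk, gk, Finset.sum_range_succ, Nat.choose]

theorem gk_tab1 : gk 1 1 = -11/24 ∧
    gk 1 2 = -13/20 ∧
    gk 1 3 = -19/20 ∧
    gk 1 4 = -10/7 ∧
    gk 1 5 = -247/112 ∧
    gk 1 6 = -251/72 ∧
    gk 1 7 = -1013/180 ∧
    gk 1 8 = -509/55 := by
  norm_num [fk, gk, Finset.sum_range_succ, Nat.choose]

theorem gk_tab2 : gk 2 1 = 41/60 ∧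
    gk 2 2 = 131/180 ∧
    gk 2 3 = 193/210 ∧
    gk 2 4 = 1079/840 ∧
    gk 2 5 = 2899/1512 ∧
    gk 2 6 = 7543/2520 ∧
    gk 2 7 = 4777/990 := by
  norm_num [fk, gk, Finset.sum_range_succ, Nat.choose]

theorem be_tab : be 0 0 = 1 ∧
    be 0 1 = 1/2 ∧
    be 0 2 = 1/3 ∧
    be 0 3 = 1/4 ∧
    be 0 4 = 1/5 ∧
    be 0 5 = 1/6 ∧
    be 1 0 = 1/2 ∧
    be 1 1 = 1/6 ∧
    be 1 2 = 1/12 ∧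
    be 1 3 = 1/20 ∧
    be 1 4 = 1/30 ∧
    be 1 5 = 1/42 ∧
    be 2 0 = 1/3 ∧
    be 2 1 = 1/12 ∧
    be 2 2 = 1/30 ∧
    be 2 3 = 1/60 ∧
    be 2 4 = 1/105 ∧
    be 2 5 = 1/168 ∧
    be 3 0 = 1/4 ∧
    be 3 1 = 1/20 ∧
    be 3 2 = 1/60 ∧
    be 3 3 = 1/140 ∧
    be 3 4 = 1/280 ∧
    be 3 5 = 1/504 ∧
    be 4 0 = 1/5 ∧
    be 4 1 = 1/30 ∧
    be 4 2 = 1/105 ∧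
    be 4 3 = 1/280 ∧
    be 4 4 = 1/630 ∧
    be 4 5 = 1/1260 ∧
    be 5 0 = 1/6 ∧
    be 5 1 = 1/42 ∧
    be 5 2 = 1/168 ∧
    be 5 3 = 1/504 ∧
    be 5 4 = 1/1260 ∧
    be 5 5 = 1/2772 := by
  norm_num [be, Nat.factorial]

theorem fk_tab : fk 0 = 2 ∧ fk 1 = 0 ∧ fk 2 = 2/3 := by
  norm_num [fk]

set_option maxHeartbeats 4000000 in
theorem val0000 : ∫ y, J (wx 0 0) (wx 0 0) y = 1160242379/907200 := by
  rw [J_xx]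
  norm_num [N1, N2, N4, shN, fk_tab, gk_tab0, gk_tab1, gk_tab2, be_tab, Finset.sum_range_succ,
    Nat.choose]

set_option maxHeartbeats 4000000 in
theorem val1000 : ∫ y, J (wx 1 0) (wx 0 0) y = 43272958/14175 := by
  rw [J_xx]
  norm_num [N1, N2, N4, shN, fk_tab, gk_tab0, gk_tab1, gk_tab2, be_tab, Finset.sum_range_succ,
    Nat.choose]

set_option maxHeartbeats 4000000 in
theorem val0100 : ∫ y, J (wx 0 1) (wx 0 0) y = 70493741/604800 := by
  rw [J_xx]
  norm_num [N1, N2, N4, shN, fk_tab, gk_tab0, gk_tab1, gk_tab2, be_tab, Finset.sum_range_succ,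
    Nat.choose]

set_option maxHeartbeats 4000000 in
theorem val2000 : ∫ y, J (wx 2 0) (wx 0 0) y = 334941985519/39916800 := by
  rw [J_xx]
  norm_num [N1, N2, N4, shN, fk_tab, gk_tab0, gk_tab1, gk_tab2, be_tab, Finset.sum_range_succ,
    Nat.choose]

set_option maxHeartbeats 4000000 in
theorem val1010 : ∫ y, J (wx 1 0) (wx 1 0) y = 5214022423/739200 := by
  rw [J_xx]
  norm_num [N1, N2, N4, shN, fk_tab, gk_tab0, gk_tab1, gk_tab2, be_tab, Finset.sum_range_succ,
    Nat.choose]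

set_option maxHeartbeats 4000000 in
theorem val1100 : ∫ y, J (wx 1 1) (wx 0 0) y = 1416175249/8870400 := by
  rw [J_xx]
  norm_num [N1, N2, N4, shN, fk_tab, gk_tab0, gk_tab1, gk_tab2, be_tab, Finset.sum_range_succ,
    Nat.choose]

set_option maxHeartbeats 4000000 in
theorem val1001 : ∫ y, J (wx 1 0) (wx 0 1) y = 12118383743/39916800 := by
  rw [J_xx]
  norm_num [N1, N2, N4, shN, fk_tab, gk_tab0, gk_tab1, gk_tab2, be_tab, Finset.sum_range_succ,
    Nat.choose]

set_option maxHeartbeats 4000000 in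
theorem val0200 : ∫ y, J (wx 0 2) (wx 0 0) y = 47610261247/119750400 := by
  rw [J_xx]
  norm_num [N1, N2, N4, shN, fk_tab, gk_tab0, gk_tab1, gk_tab2, be_tab, Finset.sum_range_succ,
    Nat.choose]

set_option maxHeartbeats 4000000 in
theorem val0101 : ∫ y, J (wx 0 1) (wx 0 1) y = 2238581/268800 := by
  rw [J_xx]
  norm_num [N1, N2, N4, shN, fk_tab, gk_tab0, gk_tab1, gk_tab2, be_tab, Finset.sum_range_succ,
    Nat.choose]

theorem mem_P (x : EuclideanSpace ℝ (Fin 10)) : x ∈ P ↔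
    (-1 ≤ x 0 ∧ -1 ≤ x 1 ∧ -1 ≤ x 2 ∧ -1 ≤ x 3 ∧ x 0 + x 1 + x 2 + x 3 ≤ 1) ∧
    (-1 ≤ x 4 ∧ -1 ≤ x 5 ∧ -1 ≤ x 6 ∧ -1 ≤ x 7 ∧ x 4 + x 5 + x 6 + x 7 ≤ 1) ∧
    ((-1 ≤ x 8 ∧ x 8 ≤ 1) ∧ -1 ≤ x 0 + x 4 ∧ -1 ≤ x 0 + x 4 + x 8) ∧
    ((-1 ≤ x 9 ∧ x 9 ≤ 1) ∧ -1 ≤ x 1 + x 5 ∧ -1 ≤ x 1 + x 5 + x 9) := by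
  unfold P V18 ee
  simp only [Set.mem_ofPred_eq, Set.mem_insert_iff, Set.mem_singleton_iff, forall_eq_or_imp,
    forall_eq, inner_neg_right, inner_add_right, EuclideanSpace.inner_single_right, ge_iff_le,
    neg_le_neg_iff, one_mul, conj_trivial]
  tauto

theorem P_closed : IsClosed P := by
  have : P = ⋂ v ∈ V18, {x : EuclideanSpace ℝ (Fin 10) | -1 ≤ ⟪x, v⟫} := by
    ext x
    simp [P]
  rw [this]
  exact isClosed_biInter fun v _ => isClosed_le continuous_const (by fun_prop)

theorem P_compact : IsCompact P := by
  refine Metric.isCompact_of_isClosed_isBounded P_closed ?_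
  rw [isBounded_iff_forall_norm_le]
  refine ⟨√(∑ _i : Fin 10, 4 ^ 2), fun x hx => ?_⟩
  rw [EuclideanSpace.norm_eq]
  refine Real.sqrt_le_sqrt (Finset.sum_le_sum fun i _ => ?_)
  rw [Real.norm_eq_abs]
  refine pow_le_pow_left₀ (abs_nonneg _) ?_ 2
  rw [mem_P] at hx
  rw [abs_le]
  obtain ⟨⟨h1, h2, h3, h4, h5⟩, ⟨h6, h7, h8, h9, h10⟩, ⟨⟨h11, h12⟩, h13, h14⟩, ⟨⟨h15, h16⟩, h17, h18⟩⟩ := hx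
  fin_cases i <;> simp only [Fin.reduceFinMk, Fin.zero_eta, Fin.mk_one] <;>
    constructor <;> linarith

theorem P_ball : Metric.ball (0 : EuclideanSpace ℝ (Fin 10)) (1 / 4) ⊆ P := by
  intro x hx
  rw [mem_ball_zero_iff] at hx
  have h : ∀ i, |x i| ≤ 1 / 4 := fun i => (PiLp.norm_apply_le x i).trans hx.le
  rw [mem_P]
  simp only [abs_le] at h
  have h0 := h 0
  have h1 := h 1
  have h2 := h 2
  have h3 := h 3
  have h4 := h 4
  have h5 := h 5
  have h6 := h 6
  have h7 := h 7
  have h8 := h 8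
  have h9 := h 9
  clear h hx
  refine ⟨⟨?_, ?_, ?_, ?_, ?_⟩, ⟨?_, ?_, ?_, ?_, ?_⟩, ⟨⟨?_, ?_⟩, ?_, ?_⟩, ⟨⟨?_, ?_⟩, ?_, ?_⟩⟩ <;>
    linarith

theorem wx_eq (i k : ℕ) (p s : ℝ) :
    wx i k p s = if (-1 ≤ s ∧ s ≤ 1) ∧ 1 ≤ p ∧ 1 ≤ p + s then p ^ i * s ^ k else 0 := by
  unfold wx wb wd
  by_cases h1 : -1 ≤ s ∧ s ≤ 1
  · by_cases h2 : 1 ≤ p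
    · by_cases h3 : 1 ≤ p + s
      · simp [h1, h2, h3]
      · simp [h1, h3, lt_of_not_ge h3]
    · simp [h1, h2, lt_of_not_ge h2]
  · simp [h1]

def tau : Equiv.Perm (Fin 10) :=
  Equiv.ofBijective ![0, 2, 6, 7, 1, 3, 8, 9, 4, 5] (by decide)

/-- reparametrisation of the space -/
def rep (y : Fin 10 → ℝ) : EuclideanSpace ℝ (Fin 10) :=
  WithLp.toLp 2 ((fun i => y (tau i)) - ![1, 1, 1, 1, 1, 1, 1, 1, 0, 0])

theorem int_rep (F : EuclideanSpace ℝ (Fin 10) → ℝ) : ∫ x, F x = ∫ y, F (rep y) := by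
  have h := EuclideanSpace.volume_preserving_symm_measurableEquiv_toLp (Fin 10)
  have h2 := h.symm.integral_comp (MeasurableEquiv.measurableEmbedding _) F
  rw [← h2]
  have h3 := integral_sub_right_eq_self (μ := (volume : Measure (Fin 10 → ℝ)))
    (fun w : Fin 10 → ℝ => F (WithLp.toLp 2 w)) ![1, 1, 1, 1, 1, 1, 1, 1, 0, 0]
  refine (h3.symm.trans ?_)
  exact (perm_int tau (fun w : Fin 10 → ℝ => F (WithLp.toLp 2 (w - ![1, 1, 1, 1, 1, 1, 1, 1, 0, 0])))).symm

theorem mom_P (i k j l : ℕ) :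
    ∫ x in P, (x 0 + x 4 + 2) ^ i * x 8 ^ k * ((x 1 + x 5 + 2) ^ j * x 9 ^ l) =
      ∫ y, J (wx i k) (wx j l) y := by
  classical
  rw [← integral_indicator P_closed.measurableSet, int_rep]
  congr 1
  funext y
  have r0 : rep y 0 = y 0 - 1 := rfl
  have r1 : rep y 1 = y 2 - 1 := rfl
  have r2 : rep y 2 = y 6 - 1 := rfl
  have r3 : rep y 3 = y 7 - 1 := rfl
  have r4 : rep y 4 = y 1 - 1 := rfl
  have r5 : rep y 5 = y 3 - 1 := rfl
  have r6 : rep y 6 = y 8 - 1 := rfl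
  have r7 : rep y 7 = y 9 - 1 := rfl
  have r8 : rep y 8 = y 4 := sub_zero (y 4)
  have r9 : rep y 9 = y 5 := sub_zero (y 5)
  have hmem := mem_P (rep y)
  unfold J
  rw [wx_eq, wx_eq, Set.indicator_apply]
  simp only [r0, r1, r2, r3, r4, r5, r6, r7, r8, r9] at hmem ⊢
  unfold sm
  by_cases h : rep y ∈ P
  · rw [if_pos h]
    rw [hmem] at h
    obtain ⟨⟨h1, h2, h3, h4, h5⟩, ⟨h6, h7, h8, h9, h10⟩, ⟨h11, h13, h14⟩, ⟨h15, h17, h18⟩⟩ := h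
    rw [if_pos ⟨by linarith, by linarith, by linarith, by linarith, by linarith⟩,
      if_pos ⟨by linarith, by linarith, by linarith, by linarith, by linarith⟩,
      if_pos ⟨h11, by linarith, by linarith⟩, if_pos ⟨h15, by linarith, by linarith⟩]
    ring
  · rw [if_neg h]
    by_contra hne
    have hne := Ne.symm hne
    simp only [mul_ne_zero_iff, ite_ne_right_iff] at hne
    obtain ⟨⟨⟨⟨h1, h2, h3, h4, h5⟩, -⟩, ⟨h6, h7, h8, h9, h10⟩, -⟩, ⟨⟨h11, h13, h14⟩, -⟩, ⟨h15, h17, h18⟩, -⟩ := hne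
    apply h
    rw [hmem]
    refine ⟨⟨?_, ?_, ?_, ?_, ?_⟩, ⟨?_, ?_, ?_, ?_, ?_⟩, ⟨h11, ?_, ?_⟩, ⟨h15, ?_, ?_⟩⟩ <;> linarith

theorem int_on_P {f : EuclideanSpace ℝ (Fin 10) → ℝ} (hf : Continuous f) : IntegrableOn f P :=
  hf.continuousOn.integrableOn_compact P_compact

theorem sym_change (g : EuclideanSpace ℝ (Fin 10) →ₗ[ℝ] EuclideanSpace ℝ (Fin 10))
    (hgg : ∀ x, g (g x) = x) (hgP : ∀ x ∈ P, g x ∈ P)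
    (f : EuclideanSpace ℝ (Fin 10) → ℝ) : ∫ x in P, f (g x) = ∫ x in P, f x := by
  have hcomp : g ∘ₗ g = LinearMap.id := LinearMap.ext hgg
  have hdet : LinearMap.det g * LinearMap.det g = 1 := by
    rw [← LinearMap.det_comp, hcomp, LinearMap.det_id]
  have hne : LinearMap.det g ≠ 0 := fun h => by simp [h] at hdet
  have habs : |(LinearMap.det g)⁻¹| = 1 := by
    rcases mul_self_eq_one_iff.mp hdet with h | h <;> simp [h]
  have hmap := Measure.map_linearMap_addHaar_eq_smul_addHaar
    (volume : Measure (EuclideanSpace ℝ (Fin 10))) hne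
  rw [habs, ENNReal.ofReal_one, one_smul] at hmap
  have hcont : Continuous g := g.continuous_of_finiteDimensional
  have hmp : MeasurePreserving g volume volume := ⟨hcont.measurable, hmap⟩
  have hemb : MeasurableEmbedding g :=
    (Homeomorph.mk (Equiv.mk g g hgg hgg) hcont hcont).measurableEmbedding
  have hpre : g ⁻¹' P = P := by
    ext x
    constructor
    · intro h
      have := hgP _ h
      rwa [hgg] at this
    · exact hgP x
  have := hmp.setIntegral_preimage_emb hemb f P
  rwa [hpre] at this

theorem lin_eq (θ : EuclideanSpace ℝ (Fin 10) → ℝ) (hc : Continuous θ)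
    (hθi : ∀ i : Fin 10, (∫ x in P, x i * θ x) = ∫ x in P, x i)
    (w : EuclideanSpace ℝ (Fin 10)) :
    ∫ x in P, ⟪w, x⟫ * θ x = ∫ x in P, ⟪w, x⟫ := by
  have hin : ∀ x : EuclideanSpace ℝ (Fin 10), ⟪w, x⟫ = ∑ i, w i * x i := fun x => by
    rw [PiLp.inner_apply]
    exact Finset.sum_congr rfl fun i _ => by simp [mul_comm]
  simp only [hin, Finset.sum_mul]
  rw [integral_finsetSum, integral_finsetSum]
  · refine Finset.sum_congr rfl fun i _ => ?_
    simp only [mul_assoc]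
    rw [integral_const_mul, integral_const_mul, hθi]
  · exact fun i _ => int_on_P (by fun_prop)
  · exact fun i _ => int_on_P (by fun_prop)

theorem sym_theta (θ : EuclideanSpace ℝ (Fin 10) → ℝ)
    (a : EuclideanSpace ℝ (Fin 10)) (c : ℝ) (haff : ∀ x, θ x = ⟪a, x⟫ + c)
    (hθi : ∀ i : Fin 10, (∫ x in P, x i * θ x) = ∫ x in P, x i)
    (g : EuclideanSpace ℝ (Fin 10) →ₗ[ℝ] EuclideanSpace ℝ (Fin 10))
    (hgg : ∀ x, g (g x) = x) (hgP : ∀ x ∈ P, g x ∈ P) (x : EuclideanSpace ℝ (Fin 10)) :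
    ⟪a, g x⟫ = ⟪a, x⟫ := by
  have hc : Continuous θ := by
    rw [funext haff]
    fun_prop
  have hcg : Continuous g := g.continuous_of_finiteDimensional
  obtain ⟨w, hw⟩ : ∃ w : EuclideanSpace ℝ (Fin 10), ∀ x, ⟪w, x⟫ = ⟪a, x⟫ - ⟪a, g x⟫ := by
    refine ⟨a - LinearMap.adjoint g a, fun x => ?_⟩
    rw [inner_sub_left, LinearMap.adjoint_inner_left]
  obtain ⟨w', hw'⟩ : ∃ w : EuclideanSpace ℝ (Fin 10), ∀ x, ⟪w, x⟫ = ⟪a, g x⟫ - ⟪a, x⟫ := by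
    refine ⟨LinearMap.adjoint g a - a, fun x => ?_⟩
    rw [inner_sub_left, LinearMap.adjoint_inner_left]
  have hwg : ∀ x, ⟪w, g x⟫ = ⟪w', x⟫ := fun x => by rw [hw, hw', hgg]
  have e1 := lin_eq θ hc hθi w
  have e2 := lin_eq θ hc hθi w'
  have e3 := sym_change g hgg hgP (fun x => ⟪w, x⟫ * θ (g x))
  simp only [hwg, hgg] at e3
  have e4 := sym_change g hgg hgP (fun x => ⟪w, x⟫)
  simp only [hwg] at e4
  have e5 : ∫ x in P, ⟪w, x⟫ ^ 2 = 0 := by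
    have : ∀ x, ⟪w, x⟫ ^ 2 = ⟪w, x⟫ * θ x - ⟪w, x⟫ * θ (g x) := fun x => by
      rw [haff, haff, hw]
      ring
    simp only [this]
    rw [integral_sub (int_on_P (by fun_prop)) (int_on_P (by fun_prop))]
    linarith
  have hww : w = 0 := by
    by_contra hne
    have hci : Continuous fun x : EuclideanSpace ℝ (Fin 10) => ⟪w, x⟫ ^ 2 :=
      (continuous_const.inner continuous_id).pow 2
    rw [integral_eq_zero_iff_of_nonneg (fun x => sq_nonneg _) (int_on_P hci)] at e5
    have h6 : (fun x : EuclideanSpace ℝ (Fin 10) => ⟪w, x⟫ ^ 2) =ᵐ[volume.restrict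
        (Metric.ball (0 : EuclideanSpace ℝ (Fin 10)) (1 / 4))] 0 :=
      ae_restrict_of_ae_restrict_of_subset P_ball e5
    have h7 := Measure.eqOn_open_of_ae_eq h6 Metric.isOpen_ball
      (by fun_prop) (by fun_prop)
    have hn : 0 < ‖w‖ := norm_pos_iff.mpr hne
    have h8 : (8 * ‖w‖)⁻¹ • w ∈ Metric.ball (0 : EuclideanSpace ℝ (Fin 10)) (1 / 4) := by
      rw [mem_ball_zero_iff, norm_smul, Real.norm_eq_abs, abs_of_pos (by positivity)]
      rw [inv_mul_lt_iff₀ (by positivity)]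
      linarith
    have h9 := h7 h8
    simp only [inner_smul_right, real_inner_self_eq_norm_sq, Pi.zero_apply] at h9
    have : 0 < ((8 * ‖w‖)⁻¹ * ‖w‖ ^ 2) ^ 2 := by positivity
    linarith
  have := hw x
  rw [hww, inner_zero_left] at this
  linarith

def mkg (f : Fin 10 → EuclideanSpace ℝ (Fin 10) →ₗ[ℝ] ℝ) :
    EuclideanSpace ℝ (Fin 10) →ₗ[ℝ] EuclideanSpace ℝ (Fin 10) :=
  (WithLp.linearEquiv 2 ℝ (Fin 10 → ℝ)).symm.toLinearMap ∘ₗ LinearMap.pi f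

theorem mkg_apply (f : Fin 10 → EuclideanSpace ℝ (Fin 10) →ₗ[ℝ] ℝ)
    (x : EuclideanSpace ℝ (Fin 10)) (i : Fin 10) : mkg f x i = f i x := rfl

/-- coordinate functionals -/
def co (i : Fin 10) : EuclideanSpace ℝ (Fin 10) →ₗ[ℝ] ℝ :=
  LinearMap.proj i ∘ₗ (WithLp.linearEquiv 2 ℝ (Fin 10 → ℝ)).toLinearMap

theorem co_apply (i : Fin 10) (x : EuclideanSpace ℝ (Fin 10)) : co i x = x i := rfl

theorem inner_a (a x : EuclideanSpace ℝ (Fin 10)) : ⟪a, x⟫ =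
    a 0 * x 0 + a 1 * x 1 + a 2 * x 2 + a 3 * x 3 + a 4 * x 4 + a 5 * x 5 + a 6 * x 6 +
    a 7 * x 7 + a 8 * x 8 + a 9 * x 9 := by
  rw [PiLp.inner_apply]
  simp [Fin.sum_univ_succ, mul_comm]
  ring!

def gA := mkg ![co 1, co 0, co 2, co 3, co 5, co 4, co 6, co 7, co 9, co 8]
def gB := mkg ![co 4, co 5, co 6, co 7, co 0, co 1, co 2, co 3, co 8, co 9]
def gC := mkg ![co 0, co 1, -(co 0 + co 1 + co 2 + co 3), co 3, co 4, co 5, co 6, co 7, co 8, co 9]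
def gD := mkg ![co 0, co 1, co 2, -(co 0 + co 1 + co 2 + co 3), co 4, co 5, co 6, co 7, co 8, co 9]

theorem gA_inv (x) : gA (gA x) = x := by
  ext i
  fin_cases i <;> rfl
theorem gB_inv (x) : gB (gB x) = x := by
  ext i
  fin_cases i <;> rfl
theorem gC_inv (x) : gC (gC x) = x := by
  ext i
  fin_cases i <;> try rfl
  change -(x 0 + x 1 + -(x 0 + x 1 + x 2 + x 3) + x 3) = x 2
  ring
theorem gD_inv (x) : gD (gD x) = x := by
  ext i
  fin_cases i <;> try rfl
  change -(x 0 + x 1 + x 2 + -(x 0 + x 1 + x 2 + x 3)) = x 3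
  ring

theorem gA_P (x) (hx : x ∈ P) : gA x ∈ P := by
  rw [mem_P] at hx ⊢
  change (-1 ≤ x 1 ∧ -1 ≤ x 0 ∧ -1 ≤ x 2 ∧ -1 ≤ x 3 ∧ x 1 + x 0 + x 2 + x 3 ≤ 1) ∧
    (-1 ≤ x 5 ∧ -1 ≤ x 4 ∧ -1 ≤ x 6 ∧ -1 ≤ x 7 ∧ x 5 + x 4 + x 6 + x 7 ≤ 1) ∧
    ((-1 ≤ x 9 ∧ x 9 ≤ 1) ∧ -1 ≤ x 1 + x 5 ∧ -1 ≤ x 1 + x 5 + x 9) ∧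
    ((-1 ≤ x 8 ∧ x 8 ≤ 1) ∧ -1 ≤ x 0 + x 4 ∧ -1 ≤ x 0 + x 4 + x 8)
  obtain ⟨⟨h1, h2, h3, h4, h5⟩, ⟨h6, h7, h8, h9, h10⟩, ⟨⟨h11, h12⟩, h13, h14⟩, ⟨⟨h15, h16⟩, h17, h18⟩⟩ := hx
  refine ⟨⟨?_, ?_, ?_, ?_, ?_⟩, ⟨?_, ?_, ?_, ?_, ?_⟩, ⟨⟨?_, ?_⟩, ?_, ?_⟩, ⟨⟨?_, ?_⟩, ?_, ?_⟩⟩ <;>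
    linarith

theorem gB_P (x) (hx : x ∈ P) : gB x ∈ P := by
  rw [mem_P] at hx ⊢
  change (-1 ≤ x 4 ∧ -1 ≤ x 5 ∧ -1 ≤ x 6 ∧ -1 ≤ x 7 ∧ x 4 + x 5 + x 6 + x 7 ≤ 1) ∧
    (-1 ≤ x 0 ∧ -1 ≤ x 1 ∧ -1 ≤ x 2 ∧ -1 ≤ x 3 ∧ x 0 + x 1 + x 2 + x 3 ≤ 1) ∧
    ((-1 ≤ x 8 ∧ x 8 ≤ 1) ∧ -1 ≤ x 4 + x 0 ∧ -1 ≤ x 4 + x 0 + x 8) ∧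
    ((-1 ≤ x 9 ∧ x 9 ≤ 1) ∧ -1 ≤ x 5 + x 1 ∧ -1 ≤ x 5 + x 1 + x 9)
  obtain ⟨⟨h1, h2, h3, h4, h5⟩, ⟨h6, h7, h8, h9, h10⟩, ⟨⟨h11, h12⟩, h13, h14⟩, ⟨⟨h15, h16⟩, h17, h18⟩⟩ := hx
  refine ⟨⟨?_, ?_, ?_, ?_, ?_⟩, ⟨?_, ?_, ?_, ?_, ?_⟩, ⟨⟨?_, ?_⟩, ?_, ?_⟩, ⟨⟨?_, ?_⟩, ?_, ?_⟩⟩ <;>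
    linarith

theorem gC_P (x) (hx : x ∈ P) : gC x ∈ P := by
  rw [mem_P] at hx ⊢
  refine ⟨?_, hx.2⟩
  change (-1 ≤ x 0 ∧ -1 ≤ x 1 ∧ -1 ≤ -(x 0 + x 1 + x 2 + x 3) ∧ -1 ≤ x 3 ∧
    x 0 + x 1 + -(x 0 + x 1 + x 2 + x 3) + x 3 ≤ 1)
  obtain ⟨⟨h1, h2, h3, h4, h5⟩, -⟩ := hx
  refine ⟨?_, ?_, ?_, ?_, ?_⟩ <;> linarith

theorem gD_P (x) (hx : x ∈ P) : gD x ∈ P := by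
  rw [mem_P] at hx ⊢
  refine ⟨?_, hx.2⟩
  change (-1 ≤ x 0 ∧ -1 ≤ x 1 ∧ -1 ≤ x 2 ∧ -1 ≤ -(x 0 + x 1 + x 2 + x 3) ∧
    x 0 + x 1 + x 2 + -(x 0 + x 1 + x 2 + x 3) ≤ 1)
  obtain ⟨⟨h1, h2, h3, h4, h5⟩, -⟩ := hx
  refine ⟨?_, ?_, ?_, ?_, ?_⟩ <;> linarith

theorem coefs (a : EuclideanSpace ℝ (Fin 10))
    (hA : ∀ x, ⟪a, gA x⟫ = ⟪a, x⟫) (hB : ∀ x, ⟪a, gB x⟫ = ⟪a, x⟫)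
    (hC : ∀ x, ⟪a, gC x⟫ = ⟪a, x⟫) (hD : ∀ x, ⟪a, gD x⟫ = ⟪a, x⟫) :
    a 1 = a 0 ∧ a 4 = a 0 ∧ a 5 = a 0 ∧ a 9 = a 8 ∧ a 2 = 0 ∧ a 3 = 0 ∧ a 6 = 0 ∧ a 7 = 0 := by
  simp only [inner_a] at hA hB hC hD
  have A0 := hA (ee 0)
  have A8 := hA (ee 8)
  have B0 := hB (ee 0)
  have B1 := hB (ee 1)
  have B2 := hB (ee 2)
  have B3 := hB (ee 3)
  have C2 := hC (ee 2)
  have D3 := hD (ee 3)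
  simp [gA, gB, gC, gD, mkg_apply, co_apply, ee] at A0 A8 B0 B1 B2 B3 C2 D3
  refine ⟨?_, ?_, ?_, ?_, ?_, ?_, ?_, ?_⟩ <;> linarith

theorem expand (f0 f1 f2 f3 f4 : EuclideanSpace ℝ (Fin 10) → ℝ) (h0 : Continuous f0)
    (h1 : Continuous f1) (h2 : Continuous f2) (h3 : Continuous f3) (h4 : Continuous f4)
    (k0 k1 k2 : ℝ) :
    ∫ x in P, (k0 * f0 x + k1 * (f1 x + f2 x) + k2 * (f3 x + f4 x)) =
      k0 * (∫ x in P, f0 x) + k1 * ((∫ x in P, f1 x) + ∫ x in P, f2 x) +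
        k2 * ((∫ x in P, f3 x) + ∫ x in P, f4 x) := by
  rw [integral_add (int_on_P (by fun_prop)) (int_on_P (by fun_prop)),
    integral_add (int_on_P (by fun_prop)) (int_on_P (by fun_prop)),
    integral_const_mul, integral_const_mul, integral_const_mul,
    integral_add (int_on_P (by fun_prop)) (int_on_P (by fun_prop)),
    integral_add (int_on_P (by fun_prop)) (int_on_P (by fun_prop))]

/-- the monomials -/
def mo (i k j l : ℕ) (x : EuclideanSpace ℝ (Fin 10)) : ℝ :=
  (x 0 + x 4 + 2) ^ i * x 8 ^ k * ((x 1 + x 5 + 2) ^ j * x 9 ^ l)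

theorem mo_cont (i k j l : ℕ) : Continuous (mo i k j l) := by
  unfold mo
  fun_prop

theorem mo_int (i k j l : ℕ) : ∫ x in P, mo i k j l x = ∫ y, J (wx i k) (wx j l) y :=
  mom_P i k j l

/-- Let `θ` be the (unique) affine function on `ℝ¹⁰` satisfying
`∫_P θ dx = 0` and `∫_P x_i·θ dx = ∫_P x_i dx` for all `i`.  Then
`θ(−1, 4, −1, −1, 4, −1, −1, −1, 1, 1) > 1`; in particular the Mabuchi constant of the
associated 10-dimensional toric Fano manifold exceeds `1`. -/
theorem stmt14 (θ : EuclideanSpace ℝ (Fin 10) → ℝ)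
    (hθaff : ∃ (a : EuclideanSpace ℝ (Fin 10)) (c : ℝ), ∀ x, θ x = ⟪a, x⟫ + c)
    (hθ0 : (∫ x in P, θ x) = 0)
    (hθi : ∀ i : Fin 10, (∫ x in P, x i * θ x) = ∫ x in P, x i) :
    1 < θ vstar := by
  obtain ⟨a, c, haff⟩ := hθaff
  obtain ⟨a1, a4, a5, a9, a2, a3, a6, a7⟩ := coefs a
    (sym_theta θ a c haff hθi gA gA_inv gA_P) (sym_theta θ a c haff hθi gB gB_inv gB_P)
    (sym_theta θ a c haff hθi gC gC_inv gC_P) (sym_theta θ a c haff hθi gD gD_inv gD_P)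
  have hc : Continuous θ := by
    rw [funext haff]
    fun_prop
  have hth : ∀ x, θ x = (c - 4 * a 0) + a 0 * ((x 0 + x 4 + 2) + (x 1 + x 5 + 2)) +
      a 8 * (x 8 + x 9) := fun x => by
    rw [haff, inner_a, a1, a4, a5, a9, a2, a3, a6, a7]
    ring
  have hv : θ vstar = c + 6 * a 0 + 2 * a 8 := by
    have v0 : vstar 0 = -1 := rfl
    have v1 : vstar 1 = 4 := rfl
    have v4 : vstar 4 = 4 := rfl
    have v5 : vstar 5 = -1 := rfl
    have v8 : vstar 8 = 1 := rfl
    have v9 : vstar 9 = 1 := rfl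
    rw [hth, v0, v1, v4, v5, v8, v9]
    ring
  -- first equation
  have E0 : ∫ x in P, θ x = (c - 4 * a 0) * (∫ x in P, mo 0 0 0 0 x) +
      a 0 * ((∫ x in P, mo 1 0 0 0 x) + ∫ x in P, mo 0 0 1 0 x) +
      a 8 * ((∫ x in P, mo 0 1 0 0 x) + ∫ x in P, mo 0 0 0 1 x) := by
    rw [← expand _ _ _ _ _ (mo_cont _ _ _ _) (mo_cont _ _ _ _) (mo_cont _ _ _ _)
      (mo_cont _ _ _ _) (mo_cont _ _ _ _)]
    congr 1
    funext x
    rw [hth]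
    simp only [mo]
    ring
  have E1 : ∫ x in P, mo 1 0 0 0 x * θ x = (c - 4 * a 0) * (∫ x in P, mo 1 0 0 0 x) +
      a 0 * ((∫ x in P, mo 2 0 0 0 x) + ∫ x in P, mo 1 0 1 0 x) +
      a 8 * ((∫ x in P, mo 1 1 0 0 x) + ∫ x in P, mo 1 0 0 1 x) := by
    rw [← expand _ _ _ _ _ (mo_cont _ _ _ _) (mo_cont _ _ _ _) (mo_cont _ _ _ _)
      (mo_cont _ _ _ _) (mo_cont _ _ _ _)]
    congr 1
    funext x
    rw [hth]
    simp only [mo]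
    ring
  have E2 : ∫ x in P, x 8 * θ x = (c - 4 * a 0) * (∫ x in P, mo 0 1 0 0 x) +
      a 0 * ((∫ x in P, mo 1 1 0 0 x) + ∫ x in P, mo 0 1 1 0 x) +
      a 8 * ((∫ x in P, mo 0 2 0 0 x) + ∫ x in P, mo 0 1 0 1 x) := by
    rw [← expand _ _ _ _ _ (mo_cont _ _ _ _) (mo_cont _ _ _ _) (mo_cont _ _ _ _)
      (mo_cont _ _ _ _) (mo_cont _ _ _ _)]
    congr 1
    funext x
    rw [hth]
    simp only [mo]
    ring
  have L1 : ∫ x in P, mo 1 0 0 0 x * θ x =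
      (∫ x in P, mo 1 0 0 0 x) - 2 * ∫ x in P, mo 0 0 0 0 x := by
    have e1 : ∫ x in P, mo 1 0 0 0 x * θ x =
        2 * (∫ x in P, θ x) + 1 * ((∫ x in P, x 0 * θ x) + ∫ x in P, x 4 * θ x) +
          0 * ((∫ x in P, θ x) + ∫ x in P, θ x) := by
      rw [← expand _ _ _ _ _ (by fun_prop) (by fun_prop) (by fun_prop) (by fun_prop)
        (by fun_prop)]
      congr 1
      funext x
      simp only [mo]
      ring
    have e2 : ∫ x in P, mo 1 0 0 0 x =
        2 * (∫ x in P, mo 0 0 0 0 x) + 1 * ((∫ x in P, x 0) + ∫ x in P, x 4) +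
          0 * ((∫ x in P, θ x) + ∫ x in P, θ x) := by
      rw [← expand _ _ _ _ _ (mo_cont _ _ _ _) (by fun_prop) (by fun_prop) (by fun_prop)
        (by fun_prop)]
      congr 1
      funext x
      simp only [mo]
      ring
    rw [e1, e2, hθ0, hθi, hθi]
    ring
  have L2 : ∫ x in P, x 8 * θ x = ∫ x in P, mo 0 1 0 0 x := by
    rw [hθi]
    congr 1
    funext x
    simp only [mo]
    ring
  rw [hθ0] at E0
  rw [L1] at E1
  rw [L2] at E2
  simp only [mo_int] at E0 E1 E2
  rw [J_swap (wx 0 0) (wx 1 0), J_swap (wx 0 0) (wx 0 1), val0000, val1000, val0100] at E0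
  rw [val0000, val1000, val2000, val1010, val1100, val1001] at E1
  rw [J_swap (wx 0 1) (wx 1 0), val0100, val1100, val1001, val0200, val0101] at E2
  rw [hv]
  linarith
end
end
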